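/- arXiv:0810.3070 — 3 statements merged into one kernel-verified Lean document; each statement's English description precedes it below -/
import Mathlib

section
/- If α < 1/2, then P( lim_{t↑T} X^{(α)}_t/(T−t)^α = M^{(α)}_T ) = 1, where M^{(α)}_T is a normally distributed random variable with mean 0 and variance T^{1−2α}/(1−2α). Consequently, P( lim_{t↑T} X^{(α)}_t/(T−t)^β = 0 ) = 1 for all β < α, and P( lim_{t↑T} X^{(α)}_t/(T−t)^β = −∞ ) = P( lim_{t↑T} X^{(α)}_t/(T−t)^β = ∞ ) = 1/2 for all β > α. -/
open MeasureTheory ProbabilityTheory Filter Set Topology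
open scoped ENNReal NNReal

noncomputable section

variable {Ω : Type*} [MeasurableSpace Ω]

/-- `B` is a standard 1-dimensional Wiener process on the probability space `(Ω, 𝒜, P)`:
it starts at `0`, has a.s. continuous paths, and its increments are independent of the past
and Gaussian with the correct variance. -/
structure IsStandardWiener (P : Measure Ω) (B : ℝ → Ω → ℝ) : Prop where
  meas : ∀ t : ℝ, Measurable (B t)
  init : ∀ᵐ ω ∂P, B 0 ω = 0
  cont : ∀ᵐ ω ∂P, Continuous fun t => B t ω
  incr_indep : ∀ s t : ℝ, 0 ≤ s → s ≤ t →
    IndepFun (fun ω => B t ω - B s ω) (fun ω (u : Set.Icc (0:ℝ) s) => B u.1 ω) P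
  incr_law : ∀ s t : ℝ, 0 ≤ s → s ≤ t →
    Measure.map (fun ω => B t ω - B s ω) P = gaussianReal 0 (Real.toNNReal (t - s))

/-- The `α`-Wiener bridge `X^{(α)}_t = ∫₀ᵗ ((T−t)/(T−s))^α dB_s`, `t ∈ [0,T)`, realized
pathwise through the integration-by-parts representation of the Wiener integral:
`X^{(α)}_t = B_t − α (T−t)^α ∫₀ᵗ (T−s)^{−α−1} B_s ds`. -/
def alphaWienerBridge (T α : ℝ) (B : ℝ → Ω → ℝ) (t : ℝ) (ω : Ω) : ℝ :=
  B t ω - α * (T - t) ^ α * ∫ s in Set.Ioc (0:ℝ) t, (T - s) ^ (-α - 1) * B s ω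

/-- An almost sure limit of centered Gaussian variables with converging variances is a centered
Gaussian variable. -/
lemma map_eq_gaussianReal_of_tendsto_ae {P : Measure Ω} [IsProbabilityMeasure P]
    {X : ℕ → Ω → ℝ} {Z : Ω → ℝ} {v : ℕ → ℝ} {w : ℝ} (hX : ∀ n, AEMeasurable (X n) P)
    (hlaw : ∀ n, Measure.map (X n) P = gaussianReal 0 (v n).toNNReal)
    (hlim : ∀ᵐ ω ∂P, Tendsto (fun n => X n ω) atTop (𝓝 (Z ω)))
    (hv : Tendsto v atTop (𝓝 w)) :
    Measure.map Z P = gaussianReal 0 w.toNNReal := by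
  have hZ : AEMeasurable Z P := aemeasurable_of_tendsto_metrizable_ae' hX hlim
  have : IsProbabilityMeasure (Measure.map Z P) := Measure.isProbabilityMeasure_map hZ
  refine Measure.ext_of_charFun (funext fun u => ?_)
  have h1 : Tendsto (fun n => charFun (Measure.map (X n) P) u) atTop
      (𝓝 (charFun (Measure.map Z P) u)) := by
    simp only [charFun_apply_real]
    have key : ∀ W : Ω → ℝ, AEMeasurable W P →
        ∫ x, Complex.exp (u * x * Complex.I) ∂(Measure.map W P)
          = ∫ ω, Complex.exp (u * W ω * Complex.I) ∂P := fun W hW =>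
      integral_map hW (by fun_prop)
    rw [key Z hZ]
    simp_rw [fun n => key (X n) (hX n)]
    refine tendsto_integral_of_dominated_convergence (fun _ => 1) (fun n => ?_)
      (integrable_const _) (fun n => ?_) ?_
    · have := hX n
      fun_prop
    · refine Eventually.of_forall fun ω => ?_
      have : (u * X n ω * Complex.I : ℂ) = ((u * X n ω : ℝ) : ℂ) * Complex.I := by push_cast; ring
      rw [this, Complex.norm_exp_ofReal_mul_I]
    · filter_upwards [hlim] with ω hω
      have hc : Continuous fun x : ℝ => Complex.exp (u * x * Complex.I) := by fun_prop
      exact (hc.tendsto _).comp hω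
  have h2 : Tendsto (fun n => charFun (Measure.map (X n) P) u) atTop
      (𝓝 (charFun (gaussianReal 0 w.toNNReal) u)) := by
    simp only [hlaw, charFun_gaussianReal]
    have hv' : Tendsto (fun n => (((v n).toNNReal : ℝ))) atTop (𝓝 ((w.toNNReal : ℝ))) :=
      ((NNReal.continuous_coe.comp continuous_real_toNNReal).tendsto w).comp hv
    have hc : Continuous fun x : ℝ =>
        Complex.exp (u * (0 : ℝ) * Complex.I - x * u ^ 2 / 2) := by fun_prop
    exact (hc.tendsto _).comp hv'
  exact tendsto_nhds_unique h1 h2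

lemma gaussianReal_zero_Ioi {v : ℝ≥0} (hv : v ≠ 0) : gaussianReal 0 v (Ioi 0) = 1 / 2 := by
  have := nullSingletonClass_gaussianReal (μ := 0) hv
  have hneg : gaussianReal 0 v (Iio 0) = gaussianReal 0 v (Ioi 0) := by
    have h : (gaussianReal 0 v).map (fun x => -x) = gaussianReal 0 v := by
      rw [gaussianReal_map_neg, neg_zero]
    conv_rhs => rw [← h, Measure.map_apply measurable_neg measurableSet_Ioi]
    congr 1
    ext x
    simp
  have hsum : gaussianReal 0 v (Ioi 0) + gaussianReal 0 v (Iio 0) = 1 := by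
    have h1 := measure_add_measure_compl (μ := gaussianReal 0 v) (measurableSet_Ioi (a := (0 : ℝ)))
    rw [compl_Ioi, measure_univ, ← measure_congr (Iio_ae_eq_Iic (a := (0 : ℝ)))] at h1
    exact h1
  rw [hneg, ← two_mul] at hsum
  rw [ENNReal.eq_div_iff (by norm_num) (by norm_num), hsum]

lemma gaussianReal_zero_Iio {v : ℝ≥0} (hv : v ≠ 0) : gaussianReal 0 v (Iio 0) = 1 / 2 := by
  have h : (gaussianReal 0 v).map (fun x => -x) = gaussianReal 0 v := by
    rw [gaussianReal_map_neg, neg_zero]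
  rw [← gaussianReal_zero_Ioi hv, ← h, Measure.map_apply measurable_neg measurableSet_Iio, h]
  congr 1
  ext x
  simp

namespace IsStandardWiener

variable {P : Measure Ω} {B : ℝ → Ω → ℝ}

/-- A sum of weighted increments of a Wiener process over consecutive intervals is Gaussian. -/
lemma map_sum_mul_increments [IsProbabilityMeasure P] (hB : IsStandardWiener P B) {t : ℕ → ℝ}
    (ht : Monotone t) (ht0 : 0 ≤ t 0) (a : ℕ → ℝ) (n : ℕ) :
    Measure.map (fun ω => ∑ k ∈ Finset.range n, a k * (B (t (k + 1)) ω - B (t k) ω)) P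
      = gaussianReal 0 (∑ k ∈ Finset.range n, a k ^ 2 * (t (k + 1) - t k)).toNNReal := by
  have hnn : ∀ k, 0 ≤ t k := fun k => ht0.trans (ht (Nat.zero_le k))
  have hstep : ∀ k, 0 ≤ t (k + 1) - t k := fun k => sub_nonneg.2 (ht (Nat.le_succ k))
  induction n with
  | zero => simp [Measure.map_const]
  | succ n ih =>
    simp only [Finset.sum_range_succ]
    have hind := hB.incr_indep (t n) (t (n + 1)) (hnn n) (ht (Nat.le_succ n))
    have hlaw := hB.incr_law (t n) (t (n + 1)) (hnn n) (ht (Nat.le_succ n))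
    have hm : Measurable fun ω => B (t (n + 1)) ω - B (t n) ω := (hB.meas _).sub (hB.meas _)
    have hlaw' : Measure.map (fun ω => a n * (B (t (n + 1)) ω - B (t n) ω)) P
        = gaussianReal 0 (a n ^ 2 * (t (n + 1) - t n)).toNNReal := by
      have h := gaussianReal_map_const_mul (μ := 0) (v := (t (n + 1) - t n).toNNReal) (a n)
      rw [← hlaw, Measure.map_map (measurable_const_mul _) hm, mul_zero] at h
      rw [show (fun ω => a n * (B (t (n + 1)) ω - B (t n) ω))
        = (fun x => a n * x) ∘ (fun ω => B (t (n + 1)) ω - B (t n) ω) from rfl, h]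
      congr 1
      ext
      simp [Real.coe_toNNReal _ (hstep n),
        Real.coe_toNNReal _ (mul_nonneg (sq_nonneg (a n)) (hstep n))]
    let ψ : (Set.Icc (0 : ℝ) (t n) → ℝ) → ℝ := fun f => ∑ k ∈ (Finset.range n).attach,
      a k * (f ⟨t (k + 1), hnn _, ht (Finset.mem_range.1 k.2)⟩
        - f ⟨t k, hnn _, ht (Finset.mem_range.1 k.2).le⟩)
    have hψ : Measurable ψ := by fun_prop
    have hind' := (hind.comp (measurable_const_mul (a n)) hψ).symm
    have hψe : ψ ∘ (fun ω (u : Set.Icc (0 : ℝ) (t n)) => B u.1 ω)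
        = fun ω => ∑ k ∈ Finset.range n, a k * (B (t (k + 1)) ω - B (t k) ω) := by
      funext ω
      exact Finset.sum_attach (Finset.range n) fun k => a k * (B (t (k + 1)) ω - B (t k) ω)
    rw [hψe] at hind'
    have h := gaussianReal_add_gaussianReal_of_indepFun hind' ih hlaw'
    rw [add_zero, ← Real.toNNReal_add (Finset.sum_nonneg fun k _ =>
      mul_nonneg (sq_nonneg (a k)) (hstep k)) (mul_nonneg (sq_nonneg (a n)) (hstep n))] at h
    exact h

lemma measureReal_le_abs_increment_le [IsProbabilityMeasure P] (hB : IsStandardWiener P B)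
    {s t c : ℝ} (hs : 0 ≤ s) (hst : s ≤ t) (hc : 0 < c) :
    P.real {ω | c ≤ |B t ω - B s ω|} ≤ (t - s) / c ^ 2 := by
  have hm : Measurable fun ω => B t ω - B s ω := (hB.meas _).sub (hB.meas _)
  have hlaw := hB.incr_law s t hs hst
  have h := meas_ge_le_variance_div_sq
    (memLp_id_gaussianReal' (μ := 0) (v := (t - s).toNNReal) 2 (by norm_num)) hc
  rw [variance_id_gaussianReal, Real.coe_toNNReal _ (sub_nonneg.2 hst)] at h
  simp only [id, integral_id_gaussianReal, sub_zero] at h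
  rw [← hlaw, Measure.map_apply hm (measurableSet_le measurable_const (by fun_prop))] at h
  exact ENNReal.toReal_le_of_le_ofReal (div_nonneg (sub_nonneg.2 hst) (sq_nonneg c)) h

/-- Ottaviani's maximal inequality for a Wiener process sampled at finitely many times. -/
lemma measureReal_exists_le_abs_sub_le [IsProbabilityMeasure P] (hB : IsStandardWiener P B)
    {t : ℕ → ℝ} (ht : Monotone t) (ht0 : 0 ≤ t 0) {c : ℝ} (hc : 0 < c) (n : ℕ) :
    P.real {ω | ∃ k ≤ n, 2 * c ≤ |B (t k) ω - B (t 0) ω|} ≤ 2 * ((t n - t 0) / c ^ 2) := by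
  have hnn : ∀ k, 0 ≤ t k := fun k => ht0.trans (ht (Nat.zero_le k))
  set q := (t n - t 0) / c ^ 2 with hq
  have hm : ∀ k j, Measurable fun ω => |B (t k) ω - B (t j) ω| := fun k j =>
    ((hB.meas _).sub (hB.meas _)).abs
  let A : ℕ → Set Ω := fun k => {ω | 2 * c ≤ |B (t k) ω - B (t 0) ω| ∧
    ∀ j < k, |B (t j) ω - B (t 0) ω| < 2 * c}
  have hA : ∀ k, MeasurableSet (A k) := fun k => by
    have h : A k = {ω | 2 * c ≤ |B (t k) ω - B (t 0) ω|} ∩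
        ⋂ j, ⋂ (_ : j < k), {ω | |B (t j) ω - B (t 0) ω| < 2 * c} := by
      ext ω
      simp [A]
    rw [h]
    exact (measurableSet_le measurable_const (hm k 0)).inter (MeasurableSet.iInter fun j =>
      MeasurableSet.iInter fun _ => measurableSet_lt (hm j 0) measurable_const)
  have hdisj : Pairwise (Function.onFun Disjoint A) := by
    intro i j hij
    refine Set.disjoint_left.2 fun ω hi hj => ?_
    rcases lt_or_gt_of_ne hij with h | h
    · exact absurd (hj.2 i h) (not_lt.2 hi.1)
    · exact absurd (hi.2 j h) (not_lt.2 hj.1)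
  have hcover : {ω | ∃ k ≤ n, 2 * c ≤ |B (t k) ω - B (t 0) ω|}
      = ⋃ k ∈ Finset.range (n + 1), A k := by
    classical
    ext ω
    simp only [Set.mem_iUnion, Finset.mem_range, exists_prop]
    constructor
    · rintro ⟨k, hk, hle⟩
      have hex : ∃ k, 2 * c ≤ |B (t k) ω - B (t 0) ω| := ⟨k, hle⟩
      refine ⟨Nat.find hex, Nat.lt_succ_of_le ((Nat.find_min' hex hle).trans hk),
        Nat.find_spec hex, fun j hj => not_le.1 (Nat.find_min hex hj)⟩
    · rintro ⟨k, hk, hle⟩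
      exact ⟨k, Nat.le_of_lt_succ hk, hle.1⟩
  let D : Set Ω := {ω | c ≤ |B (t n) ω - B (t 0) ω|}
  have hstep : ∀ k ∈ Finset.range (n + 1), (1 - q) * P.real (A k) ≤ P.real (A k ∩ D) := by
    intro k hk
    have hkn : t k ≤ t n := ht (Nat.le_of_lt_succ (Finset.mem_range.1 hk))
    let F : Set Ω := {ω | c ≤ |B (t n) ω - B (t k) ω|}
    have hF : MeasurableSet F := measurableSet_le measurable_const (hm n k)
    have hFq : P.real F ≤ q := (hB.measureReal_le_abs_increment_le (hnn k) hkn hc).trans (by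
      rw [hq]
      gcongr
      exact ht (Nat.zero_le k))
    have hprod : P.real (A k ∩ Fᶜ) = P.real (A k) * P.real Fᶜ := by
      let C : Set (Set.Icc (0 : ℝ) (t k) → ℝ) :=
        {f | 2 * c ≤ |f ⟨t k, hnn k, le_rfl⟩ - f ⟨t 0, hnn 0, ht (Nat.zero_le k)⟩|} ∩
          ⋂ j : Fin k,
            {f | |f ⟨t j, hnn j, ht j.2.le⟩ - f ⟨t 0, hnn 0, ht (Nat.zero_le k)⟩| < 2 * c}
      have hC : MeasurableSet C :=
        (measurableSet_le measurable_const (by fun_prop)).inter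
          (MeasurableSet.iInter fun _ => measurableSet_lt (by fun_prop) measurable_const)
      have hAC : A k = (fun ω (u : Set.Icc (0 : ℝ) (t k)) => B u.1 ω) ⁻¹' C := by
        ext ω
        simp only [A, C, Set.mem_ofPred_eq, Set.mem_preimage, Set.mem_inter_iff, Set.mem_iInter]
        exact and_congr_right fun _ => ⟨fun h j => h j j.2, fun h j hj => h ⟨j, hj⟩⟩
      have h := (hB.incr_indep (t k) (t n) (hnn k) hkn).symm.measure_inter_preimage_eq_mul C
        {x | c ≤ |x|}ᶜ hC (measurableSet_le measurable_const (by fun_prop)).compl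
      rw [← hAC] at h
      rw [measureReal_def, measureReal_def, measureReal_def, ← ENNReal.toReal_mul]
      exact congrArg ENNReal.toReal h
    have hsub : A k ∩ Fᶜ ⊆ A k ∩ D := by
      rintro ω ⟨hAk, hFc⟩
      refine ⟨hAk, ?_⟩
      have h1 : 2 * c ≤ |B (t k) ω - B (t 0) ω| := hAk.1
      have h2 : |B (t n) ω - B (t k) ω| < c := not_le.1 hFc
      have h3 := abs_sub_abs_le_abs_sub (B (t k) ω - B (t 0) ω) (B (t k) ω - B (t n) ω)
      rw [sub_sub_sub_cancel_left, abs_sub_comm (B (t k) ω) (B (t n) ω)] at h3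
      change c ≤ |B (t n) ω - B (t 0) ω|
      linarith
    calc (1 - q) * P.real (A k) ≤ P.real Fᶜ * P.real (A k) := by
          gcongr
          rw [probReal_compl_eq_one_sub hF]
          linarith
      _ = P.real (A k ∩ Fᶜ) := by rw [hprod, mul_comm]
      _ ≤ P.real (A k ∩ D) := measureReal_mono hsub
  have hD : MeasurableSet D := measurableSet_le measurable_const (hm n 0)
  have hsum : (1 - q) * P.real (⋃ k ∈ Finset.range (n + 1), A k) ≤ q := by
    calc (1 - q) * P.real (⋃ k ∈ Finset.range (n + 1), A k)
        = ∑ k ∈ Finset.range (n + 1), (1 - q) * P.real (A k) := by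
          rw [measureReal_biUnion_finset (fun i _ j _ hij => hdisj hij) (fun k _ => hA k),
            Finset.mul_sum]
      _ ≤ ∑ k ∈ Finset.range (n + 1), P.real (A k ∩ D) := Finset.sum_le_sum hstep
      _ = P.real (⋃ k ∈ Finset.range (n + 1), A k ∩ D) := by
          rw [measureReal_biUnion_finset _ (fun k _ => (hA k).inter hD)]
          exact fun i _ j _ hij => (hdisj hij).mono Set.inter_subset_left Set.inter_subset_left
      _ ≤ P.real D := measureReal_mono (Set.iUnion₂_subset fun k _ => Set.inter_subset_right)
      _ ≤ q := hB.measureReal_le_abs_increment_le ht0 (ht (Nat.zero_le n)) hc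
  rw [hcover]
  have h1 : P.real (⋃ k ∈ Finset.range (n + 1), A k) ≤ 1 := measureReal_le_one
  have h0 : 0 ≤ P.real (⋃ k ∈ Finset.range (n + 1), A k) := measureReal_nonneg
  have hq0 : 0 ≤ q := div_nonneg (sub_nonneg.2 (ht (Nat.zero_le n))) (sq_nonneg c)
  rcases le_or_gt (1 / 2) q with h | h <;> nlinarith

/-- Maximal inequality for a Wiener process on the interval `[a, b]`. -/
lemma measure_exists_lt_abs_sub_le [IsProbabilityMeasure P] (hB : IsStandardWiener P B)
    {a b c : ℝ} (ha : 0 ≤ a) (hab : a < b) (hc : 0 < c) :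
    P {ω | ∃ s ∈ Set.Icc a b, 2 * c < |B s ω - B a ω|} ≤
      ENNReal.ofReal (2 * ((b - a) / c ^ 2)) := by
  let g : ℕ → ℕ → ℝ := fun N k => a + k * ((b - a) / (N + 1))
  have hstep : ∀ N : ℕ, 0 < (b - a) / (N + 1) := fun N => div_pos (sub_pos.2 hab) (by positivity)
  have hg : ∀ N, Monotone (g N) := fun N i j hij => by
    have := (hstep N).le
    simp only [g]
    gcongr
  have hg0 : ∀ N, g N 0 = a := fun N => by simp [g]
  have hgN : ∀ N, g N (N + 1) = b := fun N => by
    simp only [g]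
    push_cast
    field_simp
    ring
  let E : ℕ → Set Ω := fun N => {ω | ∃ k ≤ N + 1, 2 * c ≤ |B (g N k) ω - B (g N 0) ω|}
  have hE : ∀ N, P (E N) ≤ ENNReal.ofReal (2 * ((b - a) / c ^ 2)) := fun N => by
    have h := hB.measureReal_exists_le_abs_sub_le (hg N) (by rw [hg0]; exact ha) hc (N + 1)
    rw [hgN] at h
    conv at h => rhs; rw [hg0]
    exact (ENNReal.le_ofReal_iff_toReal_le (measure_ne_top _ _) (by
      have := sub_pos.2 hab
      positivity)).2 h
  let G : ℕ → Set Ω := fun M => ⋂ N ≥ M, E N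
  have hG : Monotone G := fun i j hij =>
    Set.biInter_subset_biInter_left fun N hN => hij.trans hN
  have hsub : {ω | ∃ s ∈ Set.Icc a b, 2 * c < |B s ω - B a ω|} ≤ᵐ[P] ⋃ M, G M := by
    filter_upwards [hB.cont] with ω hω
    rintro ⟨s, hs, hlt⟩
    have hopen : ∀ᶠ r in 𝓝 s, 2 * c < |B r ω - B a ω| := by
      have : Continuous fun r => |B r ω - B a ω| := by fun_prop
      exact this.continuousAt.eventually (lt_mem_nhds hlt)
    obtain ⟨ε, hε, hball⟩ := Metric.eventually_nhds_iff.1 hopen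
    obtain ⟨M, hM⟩ := exists_nat_gt ((b - a) / ε)
    refine Set.mem_iUnion.2 ⟨M, Set.mem_iInter₂.2 fun N hN => ?_⟩
    have hd := hstep N
    have hdε : (b - a) / (N + 1) < ε := by
      rw [div_lt_iff₀ (by positivity)]
      rw [div_lt_iff₀ hε] at hM
      have : (M : ℝ) ≤ N := by exact_mod_cast hN
      nlinarith
    have hx0 : 0 ≤ (s - a) / ((b - a) / (N + 1)) := div_nonneg (sub_nonneg.2 hs.1) hd.le
    have hfl := Nat.floor_le hx0
    have hfl' := Nat.lt_floor_add_one ((s - a) / ((b - a) / (N + 1)))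
    rw [le_div_iff₀ hd] at hfl
    rw [div_lt_iff₀ hd] at hfl'
    refine ⟨⌊(s - a) / ((b - a) / (N + 1))⌋₊, ?_, ?_⟩
    · refine Nat.floor_le_of_le ?_
      rw [div_le_iff₀ hd]
      push_cast
      rw [mul_div_cancel₀ _ (by positivity)]
      linarith [hs.2]
    · rw [hg0]
      refine (hball ?_).le
      rw [Real.dist_eq, abs_lt]
      simp only [g]
      constructor <;> linarith
  calc P {ω | ∃ s ∈ Set.Icc a b, 2 * c < |B s ω - B a ω|} ≤ P (⋃ M, G M) := measure_mono_ae hsub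
    _ = ⨆ M, P (G M) := hG.measure_iUnion
    _ ≤ _ := iSup_le fun M => (measure_mono (Set.biInter_subset_of_mem (le_refl M))).trans (hE M)

/-- The paths of a Wiener process are Hölder continuous at a fixed time, from the left, with any
exponent smaller than `1 / 2`. -/
lemma ae_exists_abs_sub_le_rpow [IsProbabilityMeasure P] (hB : IsStandardWiener P B)
    {T γ : ℝ} (hT : 0 < T) (hγ0 : 0 ≤ γ) (hγ : γ < 1 / 2) :
    ∀ᵐ ω ∂P, ∃ δ > 0, ∀ s, T - δ < s → s < T → |B s ω - B T ω| ≤ 8 * (T - s) ^ γ := by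
  let h : ℕ → ℝ := fun n => T * (1 / 2) ^ n
  have hpos : ∀ n, 0 < h n := fun n => by positivity
  have hle : ∀ n, h n ≤ T := fun n =>
    mul_le_of_le_one_right hT.le (pow_le_one₀ (by norm_num) (by norm_num))
  let E : ℕ → Set Ω := fun n =>
    {ω | ∃ s ∈ Set.Icc (T - h n) T, 2 * h n ^ γ < |B s ω - B (T - h n) ω|}
  have hE : ∀ n, P (E n) ≤ ENNReal.ofReal
      (2 * T ^ (1 - 2 * γ) * ((1 / 2 : ℝ) ^ (1 - 2 * γ)) ^ n) := fun n => by
    refine (hB.measure_exists_lt_abs_sub_le (sub_nonneg.2 (hle n)) (sub_lt_self T (hpos n))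
      (Real.rpow_pos_of_pos (hpos n) γ)).trans (ENNReal.ofReal_le_ofReal (le_of_eq ?_))
    rw [sub_sub_cancel, ← Real.rpow_natCast (h n ^ γ), ← Real.rpow_mul (hpos n).le]
    nth_rewrite 1 [← Real.rpow_one (h n)]
    rw [← Real.rpow_sub (hpos n), Real.mul_rpow hT.le (by positivity), ← Real.rpow_natCast,
      ← Real.rpow_natCast, ← Real.rpow_mul (by norm_num), ← Real.rpow_mul (by norm_num)]
    push_cast
    rw [mul_comm γ 2, mul_comm (n : ℝ), mul_assoc]
  have hsum : ∑' n, P (E n) ≠ ∞ := by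
    have hs : Summable fun n : ℕ => 2 * T ^ (1 - 2 * γ) * ((1 / 2 : ℝ) ^ (1 - 2 * γ)) ^ n :=
      (summable_geometric_of_lt_one (by positivity)
        (Real.rpow_lt_one (by norm_num) (by norm_num) (by linarith))).mul_left _
    exact ne_top_of_le_ne_top hs.tsum_ofReal_ne_top (ENNReal.tsum_le_tsum hE)
  filter_upwards [ae_eventually_notMem hsum] with ω hω
  obtain ⟨N, hN⟩ := eventually_atTop.1 hω
  refine ⟨h N, hpos N, fun s hs hsT => ?_⟩
  obtain ⟨m, hm1, hm2⟩ := exists_nat_pow_near_of_lt_one (x := (T - s) / T) (y := 1 / 2)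
    (div_pos (sub_pos.2 hsT) hT) ((div_le_one hT).2 (by linarith [hle N])) (by norm_num)
    (by norm_num)
  rw [lt_div_iff₀ hT] at hm1
  rw [div_le_iff₀ hT] at hm2
  have hm1' : h m < 2 * (T - s) := by
    simp only [h]
    rw [pow_succ] at hm1
    linarith
  have hm2' : T - s ≤ h m := by simp only [h]; linarith
  have hNm : N ≤ m := by
    by_contra hlt
    have hp : (1 / 2 : ℝ) ^ N ≤ (1 / 2) ^ (m + 1) :=
      pow_le_pow_of_le_one (by norm_num) (by norm_num) (by lia)
    have : h N ≤ T * (1 / 2) ^ (m + 1) := mul_le_mul_of_nonneg_left hp hT.le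
    linarith
  have hnot := hN m hNm
  simp only [E, Set.mem_ofPred_eq, not_exists, not_and, not_lt] at hnot
  have h1 := hnot s ⟨by linarith, hsT.le⟩
  have h2 := hnot T ⟨by linarith [hpos m], le_rfl⟩
  have hγm : h m ^ γ ≤ 2 * (T - s) ^ γ := by
    calc h m ^ γ ≤ (2 * (T - s)) ^ γ := Real.rpow_le_rpow (hpos m).le hm1'.le hγ0
      _ = 2 ^ γ * (T - s) ^ γ := Real.mul_rpow (by norm_num) (sub_pos.2 hsT).le
      _ ≤ 2 ^ (1 : ℝ) * (T - s) ^ γ := by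
        have := (sub_pos.2 hsT).le
        gcongr
        · norm_num
        · linarith
      _ = 2 * (T - s) ^ γ := by rw [Real.rpow_one]
  calc |B s ω - B T ω| = |(B s ω - B (T - h m) ω) - (B T ω - B (T - h m) ω)| := by
        rw [sub_sub_sub_cancel_right]
    _ ≤ |B s ω - B (T - h m) ω| + |B T ω - B (T - h m) ω| := abs_sub _ _
    _ ≤ 8 * (T - s) ^ γ := by linarith

end IsStandardWiener

/-- Riemann–Stieltjes sums of a continuous function against a continuous density converge. -/
lemma tendsto_sum_integral_mul {w g : ℝ → ℝ} {t : ℝ} (ht : 0 ≤ t)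
    (hw : ContinuousOn w (Set.Icc 0 t)) (hg : ContinuousOn g (Set.Icc 0 t)) {p : ℕ → ℕ → ℝ}
    (hp : ∀ n k : ℕ, p n k = k * (t / (n + 1))) {c : ℕ → ℕ → ℝ}
    (hc : ∀ n k, c n k ∈ Set.Icc (p n k) (p n (k + 1))) :
    Tendsto (fun n => ∑ k ∈ Finset.range (n + 1), (∫ s in p n k..p n (k + 1), w s) * g (c n k))
      atTop (𝓝 (∫ s in 0..t, w s * g s)) := by
  have hmono : ∀ n, Monotone (p n) := fun n i j hij => by
    rw [hp, hp]
    gcongr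
  have hp0 : ∀ n, p n 0 = 0 := fun n => by simp [hp]
  have hpn : ∀ n, p n (n + 1) = t := fun n => by
    rw [hp]
    push_cast
    field_simp
  have hlen : ∀ n k, p n (k + 1) - p n k = t / (n + 1) := fun n k => by
    rw [hp, hp]
    push_cast
    ring
  have hsub : ∀ n k, k < n + 1 → Set.Icc (p n k) (p n (k + 1)) ⊆ Set.Icc 0 t := fun n k hk =>
    Set.Icc_subset_Icc (by rw [← hp0 n]; exact hmono n (Nat.zero_le k))
      (by rw [← hpn n]; exact hmono n hk)
  obtain ⟨K, hK⟩ := isCompact_Icc.exists_bound_of_continuousOn hw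
  have hK0 : 0 ≤ K := (norm_nonneg _).trans (hK 0 ⟨le_rfl, ht⟩)
  have hunif := Metric.uniformContinuousOn_iff.1
    (isCompact_Icc.uniformContinuousOn_of_continuous hg)
  rw [Metric.tendsto_atTop]
  intro ε hε
  have hKt : 0 < K * t + 1 := by positivity
  obtain ⟨δ, hδ, hgδ⟩ := hunif (ε / (K * t + 1)) (by positivity)
  obtain ⟨N, hN⟩ := exists_nat_gt (t / δ)
  refine ⟨N, fun n hn => ?_⟩
  have hmesh : t / (n + 1) < δ := by
    rw [div_lt_iff₀ (by positivity)]
    rw [div_lt_iff₀ hδ] at hN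
    have : (N : ℝ) ≤ n := by exact_mod_cast hn
    nlinarith
  have hii : ∀ k, k < n + 1 → ∀ h : ℝ → ℝ, ContinuousOn h (Set.Icc 0 t) →
      IntervalIntegrable h volume (p n k) (p n (k + 1)) := fun k hk h hh => by
    refine ContinuousOn.intervalIntegrable ?_
    rw [Set.uIcc_of_le (hmono n (Nat.le_succ k))]
    exact hh.mono (hsub n k hk)
  have hwg : ContinuousOn (fun s => w s * g s) (Set.Icc 0 t) := hw.mul hg
  have hsplit : ∫ s in 0..t, w s * g s
      = ∑ k ∈ Finset.range (n + 1), ∫ s in p n k..p n (k + 1), w s * g s := by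
    rw [intervalIntegral.sum_integral_adjacent_intervals fun k hk => hii k hk _ hwg, hp0, hpn]
  rw [dist_eq_norm, hsplit, ← Finset.sum_sub_distrib]
  have hterm : ∀ k ∈ Finset.range (n + 1),
      ‖(∫ s in p n k..p n (k + 1), w s) * g (c n k) - ∫ s in p n k..p n (k + 1), w s * g s‖
        ≤ K * (ε / (K * t + 1)) * (t / (n + 1)) := by
    intro k hk
    have hk' := Finset.mem_range.1 hk
    rw [← intervalIntegral.integral_mul_const, ← intervalIntegral.integral_sub
      ((hii k hk' w hw).mul_const _) (hii k hk' _ hwg)]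
    refine (intervalIntegral.norm_integral_le_of_norm_le_const
      (C := K * (ε / (K * t + 1))) fun s hs => ?_).trans (le_of_eq ?_)
    · rw [Set.uIoc_of_le (hmono n (Nat.le_succ k))] at hs
      have hs' := hsub n k hk' (Set.Ioc_subset_Icc_self hs)
      rw [← mul_sub, norm_mul]
      refine mul_le_mul (hK s hs') ?_ (norm_nonneg _) hK0
      rw [← dist_eq_norm]
      refine (hgδ _ (hsub n k hk' (hc n k)) _ hs' ?_).le
      have h1 := hc n k
      have h2 := hlen n k
      rw [Real.dist_eq, abs_lt]
      constructor <;> linarith [h1.1, h1.2, hs.1, hs.2]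
    · rw [hlen, abs_of_nonneg (by positivity)]
  calc _ ≤ ∑ _k ∈ Finset.range (n + 1), K * (ε / (K * t + 1)) * (t / (n + 1)) :=
        norm_sum_le_of_le _ hterm
    _ = K * t * (ε / (K * t + 1)) := by
        rw [Finset.sum_const, Finset.card_range, nsmul_eq_mul]
        push_cast
        field_simp
    _ < ε := by
        rw [mul_div_assoc', div_lt_iff₀ hKt]
        nlinarith

lemma hasDerivAt_sub_rpow {T s : ℝ} (hs : s < T) (r : ℝ) :
    HasDerivAt (fun s => (T - s) ^ r) (-r * (T - s) ^ (r - 1)) s := by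
  have h := ((hasDerivAt_id s).const_sub T).rpow_const (p := r) (Or.inl (sub_pos.2 hs).ne')
  simpa [mul_comm, mul_assoc] using h

lemma continuousOn_sub_rpow (T r : ℝ) : ContinuousOn (fun s => (T - s) ^ r) (Set.Iio T) :=
  fun _ hs => (hasDerivAt_sub_rpow hs r).continuousAt.continuousWithinAt

lemma integral_mul_sub_rpow {T a b : ℝ} (ha : a < T) (hb : b < T) (r : ℝ) :
    ∫ s in a..b, -r * (T - s) ^ (r - 1) = (T - b) ^ r - (T - a) ^ r := by
  have hsub : Set.uIcc a b ⊆ Set.Iio T := fun s hs => (Set.mem_uIcc.1 hs).elim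
    (fun h => h.2.trans_lt hb) (fun h => h.2.trans_lt ha)
  exact intervalIntegral.integral_eq_sub_of_hasDerivAt
    (fun s hs => hasDerivAt_sub_rpow (hsub hs) r)
    (((continuousOn_sub_rpow T (r - 1)).mono hsub).const_mul _).intervalIntegrable

lemma alphaWienerBridge_div_rpow {Ω : Type*} {T α t : ℝ} (ht0 : 0 ≤ t) (ht : t < T)
    (B : ℝ → Ω → ℝ) (ω : Ω) :
    alphaWienerBridge T α B t ω / (T - t) ^ α
      = B t ω * (T - t) ^ (-α) - ∫ s in 0..t, α * (T - s) ^ (-α - 1) * B s ω := by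
  have hpos : 0 < (T - t) ^ α := Real.rpow_pos_of_pos (sub_pos.2 ht) α
  simp_rw [mul_assoc α]
  rw [intervalIntegral.integral_const_mul, alphaWienerBridge,
    intervalIntegral.integral_of_le ht0, Real.rpow_neg (sub_pos.2 ht).le]
  field_simp

/-- Pathwise convergence of the normalized bridge, for a path which is Hölder continuous at `T`
from the left with an exponent larger than `α`. -/
lemma exists_tendsto_alphaWienerBridge_div_rpow {Ω : Type*} {T α γ C δ : ℝ} (hT : 0 < T)
    (hα : α < γ) (hδ : 0 < δ) {B : ℝ → Ω → ℝ} {ω : Ω} (hcont : Continuous fun t => B t ω)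
    (hB : ∀ s, T - δ < s → s < T → |B s ω - B T ω| ≤ C * (T - s) ^ γ) :
    ∃ ℓ, Tendsto (fun t => alphaWienerBridge T α B t ω / (T - t) ^ α) (𝓝[<] T) (𝓝 ℓ) := by
  let φ : ℝ → ℝ := fun s => α * (T - s) ^ (-α - 1) * (B s ω - B T ω)
  have hφc : ContinuousOn φ (Set.Iio T) :=
    ((continuousOn_sub_rpow T (-α - 1)).const_mul α).mul (by fun_prop)
  have hφ : IntervalIntegrable φ volume 0 T := by
    obtain ⟨a, ha, haT⟩ := exists_between (max_lt hT (sub_lt_self T hδ))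
    have ha0 : 0 ≤ a := (le_max_left _ _).trans ha.le
    have haδ : T - δ < a := (le_max_right _ _).trans_lt ha
    have h1 : IntervalIntegrable φ volume 0 a := by
      refine (hφc.mono ?_).intervalIntegrable
      rw [Set.uIcc_of_le ha0]
      exact fun s hs => hs.2.trans_lt haT
    have h2 : IntervalIntegrable (fun s => |α| * C * (T - s) ^ (γ - α - 1)) volume a T := by
      have h := (intervalIntegral.intervalIntegrable_rpow' (r := γ - α - 1) (a := T - a) (b := 0)
        (by linarith)).comp_sub_left T
      simpa using h.const_mul (|α| * C)
    refine h1.trans (h2.mono_fun' ?_ ?_)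
    · rw [Set.uIoc_of_le haT.le, ← restrict_Ioo_eq_restrict_Ioc]
      exact (hφc.mono fun s hs => hs.2).aestronglyMeasurable measurableSet_Ioo
    · rw [Set.uIoc_of_le haT.le, ← restrict_Ioo_eq_restrict_Ioc]
      refine (ae_restrict_mem measurableSet_Ioo).mono fun s hs => ?_
      have hpos : 0 < T - s := sub_pos.2 hs.2
      have hb := hB s (haδ.trans hs.1) hs.2
      calc ‖φ s‖ = |α| * (T - s) ^ (-α - 1) * |B s ω - B T ω| := by
            simp only [φ, norm_mul, Real.norm_eq_abs,
              abs_of_pos (Real.rpow_pos_of_pos hpos (-α - 1))]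
        _ ≤ |α| * (T - s) ^ (-α - 1) * (C * (T - s) ^ γ) := by gcongr
        _ = |α| * C * (T - s) ^ (γ - α - 1) := by
            rw [show γ - α - 1 = (-α - 1) + γ by ring, Real.rpow_add hpos]
            ring
  have hlim : Tendsto (fun t => ∫ s in 0..t, φ s) (𝓝[<] T) (𝓝 (∫ s in 0..T, φ s)) := by
    have hc := intervalIntegral.continuousOn_primitive_interval' hφ Set.left_mem_uIcc
    rw [Set.uIcc_of_le hT.le] at hc
    exact (hc T ⟨hT.le, le_rfl⟩).mono_left
      (nhdsWithin_le_iff.2 (Icc_mem_nhdsLT hT))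
  have hbdry : Tendsto (fun t => (B t ω - B T ω) * (T - t) ^ (-α)) (𝓝[<] T) (𝓝 0) := by
    have hz : Tendsto (fun t => C * (T - t) ^ (γ - α)) (𝓝[<] T) (𝓝 0) := by
      have hc : Continuous fun t : ℝ => C * (T - t) ^ (γ - α) :=
        ((continuous_const.sub continuous_id).rpow_const
          fun _ => Or.inr (sub_pos.2 hα).le).const_mul C
      have h := (hc.tendsto T).mono_left (nhdsWithin_le_nhds (s := Set.Iio T))
      rwa [sub_self, Real.zero_rpow (sub_pos.2 hα).ne', mul_zero] at h
    refine squeeze_zero_norm' ?_ hz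
    filter_upwards [Ioo_mem_nhdsLT (sub_lt_self T hδ)] with t ht
    have hpos : 0 < T - t := sub_pos.2 ht.2
    have hb := hB t ht.1 ht.2
    rw [norm_mul, Real.norm_eq_abs, Real.norm_eq_abs, abs_of_pos (Real.rpow_pos_of_pos hpos _)]
    calc |B t ω - B T ω| * (T - t) ^ (-α) ≤ C * (T - t) ^ γ * (T - t) ^ (-α) := by gcongr
      _ = C * (T - t) ^ (γ - α) := by
        rw [mul_assoc, ← Real.rpow_add hpos, ← sub_eq_add_neg]
  refine ⟨0 + B T ω * T ^ (-α) - ∫ s in 0..T, φ s, ?_⟩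
  refine ((hbdry.add tendsto_const_nhds).sub hlim).congr' ?_
  filter_upwards [Ioo_mem_nhdsLT hT] with t ht
  rw [alphaWienerBridge_div_rpow ht.1.le ht.2]
  have hsub : Set.uIcc 0 t ⊆ Set.Iio T := by
    rw [Set.uIcc_of_le ht.1.le]
    exact fun s hs => hs.2.trans_lt ht.2
  have hw : ContinuousOn (fun s => α * (T - s) ^ (-α - 1)) (Set.uIcc 0 t) :=
    ((continuousOn_sub_rpow T (-α - 1)).mono hsub).const_mul α
  have hint := integral_mul_sub_rpow hT ht.2 (-α)
  rw [neg_neg, sub_zero] at hint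
  have hsplit : ∫ s in 0..t, α * (T - s) ^ (-α - 1) * B s ω
      = (∫ s in 0..t, φ s) + (∫ s in 0..t, α * (T - s) ^ (-α - 1)) * B T ω := by
    rw [← intervalIntegral.integral_mul_const, ← intervalIntegral.integral_add
      (hφc.mono hsub).intervalIntegrable (hw.intervalIntegrable.mul_const _)]
    refine intervalIntegral.integral_congr fun s _ => ?_
    simp only [φ]
    ring
  rw [hsplit, hint]
  ring

namespace IsStandardWiener

variable {P : Measure Ω} {B : ℝ → Ω → ℝ}

lemma law_alphaWienerBridge_div_rpow [IsProbabilityMeasure P] (hB : IsStandardWiener P B)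
    {T α t : ℝ} (ht0 : 0 ≤ t) (ht : t < T) :
    AEMeasurable (fun ω => alphaWienerBridge T α B t ω / (T - t) ^ α) P ∧
    Measure.map (fun ω => alphaWienerBridge T α B t ω / (T - t) ^ α) P
      = gaussianReal 0 (∫ s in 0..t, (T - s) ^ (-(2 * α))).toNNReal := by
  let p : ℕ → ℕ → ℝ := fun n k => k * (t / (n + 1))
  have hmono : ∀ n, Monotone (p n) := fun n i j hij => by
    simp only [p]
    gcongr
  have hp0 : ∀ n, p n 0 = 0 := fun n => by simp [p]
  have hpn : ∀ n, p n (n + 1) = t := fun n => by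
    simp only [p]
    push_cast
    field_simp
  have hpT : ∀ n k, k ≤ n + 1 → p n k < T := fun n k hk =>
    ((hmono n hk).trans_eq (hpn n)).trans_lt ht
  have hIcc : Set.Icc 0 t ⊆ Set.Iio T := fun s hs => hs.2.trans_lt ht
  let S : ℕ → Ω → ℝ := fun n ω => ∑ k ∈ Finset.range (n + 1),
    (T - p n (k + 1)) ^ (-α) * (B (p n (k + 1)) ω - B (p n k) ω)
  have hS : ∀ n, AEMeasurable (S n) P := fun n => by
    have := hB.meas
    simp only [S]
    fun_prop
  have hlaw := fun n => hB.map_sum_mul_increments (hmono n) (hp0 n).ge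
    (fun k => (T - p n (k + 1)) ^ (-α)) (n + 1)
  have hlim : ∀ᵐ ω ∂P, Tendsto (fun n => S n ω) atTop
      (𝓝 (alphaWienerBridge T α B t ω / (T - t) ^ α)) := by
    filter_upwards [hB.cont, hB.init] with ω hc h0
    rw [alphaWienerBridge_div_rpow ht0 ht]
    have h := tendsto_sum_integral_mul (p := p) (c := p) ht0
      (((continuousOn_sub_rpow T (-α - 1)).mono hIcc).const_mul α) hc.continuousOn
      (fun _ _ => rfl) (fun n k => ⟨le_rfl, hmono n (Nat.le_succ k)⟩)
    refine (h.const_sub (B t ω * (T - t) ^ (-α))).congr fun n => ?_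
    have habel : ∀ (f b : ℕ → ℝ) (m : ℕ), ∑ k ∈ Finset.range m, f (k + 1) * (b (k + 1) - b k)
        = b m * f m - b 0 * f 0 - ∑ k ∈ Finset.range m, (f (k + 1) - f k) * b k := by
      intro f b m
      induction m with
      | zero => simp
      | succ m ih =>
        rw [Finset.sum_range_succ, Finset.sum_range_succ, ih]
        ring
    simp only [S]
    rw [habel (fun k => (T - p n k) ^ (-α)) (fun k => B (p n k) ω), hpn, hp0, h0, zero_mul,
      sub_zero]
    congr 1
    refine Finset.sum_congr rfl fun k hk => ?_
    have hk := Finset.mem_range.1 hk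
    have hi := integral_mul_sub_rpow (hpT n k hk.le) (hpT n (k + 1) hk) (-α)
    rw [neg_neg] at hi
    rw [hi]
  have hvar : Tendsto (fun n => ∑ k ∈ Finset.range (n + 1),
      ((T - p n (k + 1)) ^ (-α)) ^ 2 * (p n (k + 1) - p n k)) atTop
      (𝓝 (∫ s in 0..t, (T - s) ^ (-(2 * α)))) := by
    have h := tendsto_sum_integral_mul (w := fun _ => 1) (p := p) (c := fun n k => p n (k + 1)) ht0
      continuousOn_const ((continuousOn_sub_rpow T (-(2 * α))).mono hIcc)
      (fun _ _ => rfl) (fun n k => ⟨hmono n (Nat.le_succ k), le_rfl⟩)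
    simp only [one_mul] at h
    refine h.congr fun n => Finset.sum_congr rfl fun k hk => ?_
    have hpos : 0 < T - p n (k + 1) := sub_pos.2 (hpT n (k + 1) (Finset.mem_range.1 hk))
    rw [intervalIntegral.integral_const, smul_eq_mul, mul_one, ← Real.rpow_natCast,
      ← Real.rpow_mul hpos.le, mul_comm]
    congr 2
    push_cast
    ring
  exact ⟨aemeasurable_of_tendsto_metrizable_ae' hS hlim,
    map_eq_gaussianReal_of_tendsto_ae hS hlaw hlim hvar⟩

end IsStandardWiener

/-- If `α < 1/2` then a.s. `X^{(α)}_t/(T−t)^α` converges, as `t ↑ T`, to a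
random variable `M^{(α)}_T` which is centered Gaussian with variance `T^{1−2α}/(1−2α)`.
Consequently, for `β < α` one has `X^{(α)}_t/(T−t)^β → 0` a.s., while for `β > α` the events
`{X^{(α)}_t/(T−t)^β → −∞}` and `{X^{(α)}_t/(T−t)^β → ∞}` each have probability `1/2`. -/
theorem alphaWienerBridge_limit_of_lt_half
    (P : Measure Ω) [IsProbabilityMeasure P]
    (T α : ℝ) (hT : 0 < T) (hα : α < 1/2) (B : ℝ → Ω → ℝ) (hB : IsStandardWiener P B) :
    ∃ L : Ω → ℝ,
      Measure.map L P = gaussianReal 0 (Real.toNNReal (T ^ (1 - 2*α) / (1 - 2*α))) ∧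
      (∀ᵐ ω ∂P, Tendsto (fun t => alphaWienerBridge T α B t ω / (T - t) ^ α)
        (𝓝[<] T) (𝓝 (L ω))) ∧
      (∀ β : ℝ, β < α → ∀ᵐ ω ∂P,
        Tendsto (fun t => alphaWienerBridge T α B t ω / (T - t) ^ β) (𝓝[<] T) (𝓝 0)) ∧
      (∀ β : ℝ, α < β →
        P {ω | Tendsto (fun t => alphaWienerBridge T α B t ω / (T - t) ^ β) (𝓝[<] T) atBot}
            = 1/2 ∧
        P {ω | Tendsto (fun t => alphaWienerBridge T α B t ω / (T - t) ^ β) (𝓝[<] T) atTop}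
            = 1/2) := by
  obtain ⟨γ, hγ, hγ2⟩ := exists_between (max_lt hα (by norm_num : (0 : ℝ) < 1 / 2))
  have hαγ : α < γ := (le_max_left _ _).trans_lt hγ
  have hconv : ∀ᵐ ω ∂P, ∃ ℓ,
      Tendsto (fun t => alphaWienerBridge T α B t ω / (T - t) ^ α) (𝓝[<] T) (𝓝 ℓ) := by
    filter_upwards [hB.cont,
      hB.ae_exists_abs_sub_le_rpow hT ((le_max_right _ _).trans hγ.le) hγ2] with ω hc hH
    obtain ⟨δ, hδ, hH⟩ := hH
    exact exists_tendsto_alphaWienerBridge_div_rpow hT hαγ hδ hc hH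
  let L : Ω → ℝ := fun ω =>
    limUnder (𝓝[<] T) fun t => alphaWienerBridge T α B t ω / (T - t) ^ α
  have hL : ∀ᵐ ω ∂P, Tendsto (fun t => alphaWienerBridge T α B t ω / (T - t) ^ α)
      (𝓝[<] T) (𝓝 (L ω)) := hconv.mono fun ω h => tendsto_nhds_limUnder h
  have h12 : 0 < 1 - 2 * α := by linarith
  have hvpos : 0 < T ^ (1 - 2 * α) / (1 - 2 * α) := div_pos (Real.rpow_pos_of_pos hT _) h12
  let τ : ℕ → ℝ := fun n => T - T * (1 / ((n : ℝ) + 1))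
  have hτT : ∀ n, τ n < T := fun n => sub_lt_self T (by positivity)
  have hτ0 : ∀ n, 0 ≤ τ n := fun n => by
    have h : 1 / ((n : ℝ) + 1) ≤ 1 := (div_le_one (by positivity)).2 (by simp)
    simp only [τ]
    nlinarith
  have hτ : Tendsto τ atTop (𝓝[<] T) := by
    refine tendsto_nhdsWithin_iff.2 ⟨?_, Eventually.of_forall hτT⟩
    have h := (tendsto_one_div_add_atTop_nhds_zero_nat (𝕜 := ℝ)).const_mul T |>.const_sub T
    rwa [mul_zero, sub_zero] at h
  have hvar : Tendsto (fun n => ∫ s in 0..τ n, (T - s) ^ (-(2 * α))) atTop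
      (𝓝 (T ^ (1 - 2 * α) / (1 - 2 * α))) := by
    have hint : ∀ t < T, ∫ s in 0..t, (T - s) ^ (-(2 * α))
        = (T ^ (1 - 2 * α) - (T - t) ^ (1 - 2 * α)) / (1 - 2 * α) := fun t ht => by
      have h := integral_mul_sub_rpow hT ht (1 - 2 * α)
      rw [intervalIntegral.integral_const_mul, sub_zero,
        show 1 - 2 * α - 1 = -(2 * α) by ring] at h
      rw [eq_div_iff h12.ne']
      linarith
    simp_rw [fun n => hint (τ n) (hτT n)]
    have hc : Continuous fun t : ℝ =>
        (T ^ (1 - 2 * α) - (T - t) ^ (1 - 2 * α)) / (1 - 2 * α) :=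
      (continuous_const.sub ((continuous_const.sub continuous_id).rpow_const
        fun _ => Or.inr h12.le)).div_const _
    have h := (hc.tendsto T).comp (tendsto_nhdsWithin_iff.1 hτ).1
    rwa [sub_self, Real.zero_rpow h12.ne', sub_zero] at h
  have hY := fun n => hB.law_alphaWienerBridge_div_rpow (α := α) (hτ0 n) (hτT n)
  have hLτ : ∀ᵐ ω ∂P, Tendsto (fun n => alphaWienerBridge T α B (τ n) ω / (T - τ n) ^ α) atTop
      (𝓝 (L ω)) := hL.mono fun ω h => h.comp hτ
  have hLm : AEMeasurable L P := aemeasurable_of_tendsto_metrizable_ae' (fun n => (hY n).1) hLτ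
  have hlaw : Measure.map L P
      = gaussianReal 0 (Real.toNNReal (T ^ (1 - 2 * α) / (1 - 2 * α))) :=
    map_eq_gaussianReal_of_tendsto_ae (fun n => (hY n).1) (fun n => (hY n).2) hLτ hvar
  have hv : Real.toNNReal (T ^ (1 - 2 * α) / (1 - 2 * α)) ≠ 0 := (Real.toNNReal_pos.2 hvpos).ne'
  have hTt : Tendsto (fun t => T - t) (𝓝[<] T) (𝓝[>] 0) := by
    refine tendsto_nhdsWithin_iff.2 ⟨?_, ?_⟩
    · have h : Tendsto (fun t => T - t) (𝓝 T) (𝓝 (T - T)) := tendsto_id.const_sub T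
      rw [sub_self] at h
      exact h.mono_left nhdsWithin_le_nhds
    · filter_upwards [self_mem_nhdsWithin] with t ht
      exact sub_pos.2 (Set.mem_Iio.1 ht)
  have hsplit : ∀ (β : ℝ) (ω : Ω), (fun t => alphaWienerBridge T α B t ω / (T - t) ^ α
      * (T - t) ^ (α - β)) =ᶠ[𝓝[<] T] fun t => alphaWienerBridge T α B t ω / (T - t) ^ β := by
    intro β ω
    filter_upwards [self_mem_nhdsWithin] with t ht
    have hpos : 0 < T - t := sub_pos.2 (Set.mem_Iio.1 ht)
    have := (Real.rpow_pos_of_pos hpos α).ne'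
    rw [Real.rpow_sub hpos]
    field_simp
  refine ⟨L, hlaw, hL, fun β hβ => ?_, fun β hβ => ?_⟩
  · filter_upwards [hL] with ω hω
    have hz : Tendsto (fun t => (T - t) ^ (α - β)) (𝓝[<] T) (𝓝 0) := by
      have hc : Continuous fun x : ℝ => x ^ (α - β) :=
        Real.continuous_rpow_const (sub_pos.2 hβ).le
      have h := (hc.tendsto 0).comp (tendsto_nhdsWithin_iff.1 hTt).1
      rwa [Real.zero_rpow (sub_pos.2 hβ).ne'] at h
    have h := (hω.mul hz).congr' (hsplit β ω)
    rwa [mul_zero] at h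
  · have htop : Tendsto (fun t => (T - t) ^ (α - β)) (𝓝[<] T) atTop :=
      (tendsto_rpow_neg_nhdsGT_zero (sub_neg.2 hβ)).comp hTt
    have hL0 : ∀ᵐ ω ∂P, L ω ≠ 0 := by
      have := nullSingletonClass_gaussianReal (μ := 0) hv
      have h : ∀ᵐ x ∂(Measure.map L P), x ≠ 0 := by
        rw [hlaw]
        exact Measure.ae_ne _ 0
      exact ae_of_ae_map hLm h
    have hpos : ∀ᵐ ω ∂P, 0 < L ω →
        Tendsto (fun t => alphaWienerBridge T α B t ω / (T - t) ^ β) (𝓝[<] T) atTop := by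
      filter_upwards [hL] with ω hω h0
      exact (hω.pos_mul_atTop h0 htop).congr' (hsplit β ω)
    have hneg : ∀ᵐ ω ∂P, L ω < 0 →
        Tendsto (fun t => alphaWienerBridge T α B t ω / (T - t) ^ β) (𝓝[<] T) atBot := by
      filter_upwards [hL] with ω hω h0
      exact (hω.neg_mul_atTop h0 htop).congr' (hsplit β ω)
    constructor
    · rw [← gaussianReal_zero_Iio hv, ← hlaw, Measure.map_apply_of_aemeasurable hLm
        measurableSet_Iio]
      refine measure_congr ?_
      filter_upwards [hL0, hpos, hneg] with ω h0 hp hn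
      refine propext ⟨fun h => ?_, fun h => hn h⟩
      refine h0.lt_or_gt.resolve_right fun h' => ?_
      exact (hp h').not_tendsto disjoint_atTop_atBot h
    · rw [← gaussianReal_zero_Ioi hv, ← hlaw, Measure.map_apply_of_aemeasurable hLm
        measurableSet_Ioi]
      refine measure_congr ?_
      filter_upwards [hL0, hpos, hneg] with ω h0 hp hn
      refine propext ⟨fun h => ?_, fun h => hp h⟩
      refine h0.lt_or_gt.resolve_left fun h' => ?_
      exact (hn h').not_tendsto disjoint_atTop_atBot.symm h
end
end

section
/- For every α < 0 one has P( lim_{t↑T} X^{(α)}_t = −∞ ) = P( lim_{t↑T} X^{(α)}_t = ∞ ) = 1/2. Consequently, for α < 0 there does not exist an almost surely continuous process (Y^{(α)}_t)_{t∈[0,T]} such that P(X^{(α)}_t = Y^{(α)}_t) = 1 for all t ∈ [0,T). -/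
open MeasureTheory ProbabilityTheory Filter Set Topology
open scoped ENNReal NNReal

noncomputable section

variable {Ω : Type*} [MeasurableSpace Ω]

/-- The `k`-th point of the partition of `[0, T]` into `n + 1` intervals of equal length. -/
def partitionPoint (T : ℝ) (n k : ℕ) : ℝ := k * T / (n + 1)

@[simp] lemma partitionPoint_zero (T : ℝ) (n : ℕ) : partitionPoint T n 0 = 0 := by
  simp [partitionPoint]

@[simp] lemma partitionPoint_last (T : ℝ) (n : ℕ) : partitionPoint T n (n + 1) = T := by
  have : (n : ℝ) + 1 ≠ 0 := by positivity
  simp [partitionPoint, this]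

lemma partitionPoint_mono {T : ℝ} (hT : 0 ≤ T) (n : ℕ) : Monotone (partitionPoint T n) := by
  intro i j hij
  unfold partitionPoint
  gcongr

lemma partitionPoint_succ_sub (T : ℝ) (n k : ℕ) :
    partitionPoint T n (k + 1) - partitionPoint T n k = T / (n + 1) := by
  simp only [partitionPoint, Nat.cast_add, Nat.cast_one]
  ring

lemma partitionPoint_mem_Icc {T : ℝ} (hT : 0 ≤ T) {n k : ℕ} (hk : k ≤ n + 1) :
    partitionPoint T n k ∈ Icc 0 T := by
  constructor
  · simpa using partitionPoint_mono hT n (Nat.zero_le k)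
  · simpa using partitionPoint_mono hT n hk

/-- Tagged Riemann sums of a continuous function against an integrable density converge. -/
lemma tendsto_sum_mul_integral_partition {φ b : ℝ → ℝ} {T : ℝ} (hT : 0 ≤ T)
    (hφ : IntervalIntegrable φ volume 0 T) (hb : Continuous b) {ξ : ℕ → ℕ → ℝ}
    (hξ : ∀ n, ∀ k ≤ n, ξ n k ∈ Icc (partitionPoint T n k) (partitionPoint T n (k + 1))) :
    Tendsto (fun n : ℕ => ∑ k ∈ Finset.range (n + 1),
      b (ξ n k) * ∫ s in partitionPoint T n k..partitionPoint T n (k + 1), φ s)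
      atTop (𝓝 (∫ s in (0 : ℝ)..T, φ s * b s)) := by
  rw [Metric.tendsto_atTop]
  intro ε hε
  set C := ∫ s in (0 : ℝ)..T, |φ s| with hC
  have hC0 : 0 ≤ C := intervalIntegral.integral_nonneg hT fun _ _ => abs_nonneg _
  obtain ⟨δ, hδ, hδb⟩ := Metric.uniformContinuousOn_iff.1
    (isCompact_Icc.uniformContinuousOn_of_continuous (hb.continuousOn (s := Icc 0 T)))
    (ε / (C + 1)) (by positivity)
  have hmesh : ∀ᶠ n : ℕ in atTop, T / ((n : ℝ) + 1) < δ :=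
    (tendsto_const_nhds.div_atTop (tendsto_natCast_atTop_atTop.atTop_add
      (tendsto_const_nhds (x := (1 : ℝ))))).eventually_lt_const hδ
  obtain ⟨N, hN⟩ := eventually_atTop.1 hmesh
  refine ⟨N, fun n hn => ?_⟩
  have hmono := partitionPoint_mono hT n
  have hsub : ∀ k < n + 1, uIcc (partitionPoint T n k) (partitionPoint T n (k + 1))
      ⊆ uIcc 0 T := by
    intro k hk
    rw [uIcc_of_le (hmono k.le_succ), uIcc_of_le hT]
    exact Icc_subset_Icc (partitionPoint_mem_Icc hT hk.le).1 (partitionPoint_mem_Icc hT hk).2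
  have hφb : IntervalIntegrable (fun s => φ s * b s) volume 0 T :=
    hφ.mul_continuousOn hb.continuousOn
  have hsum : ∫ s in (0 : ℝ)..T, φ s * b s = ∑ k ∈ Finset.range (n + 1),
      ∫ s in partitionPoint T n k..partitionPoint T n (k + 1), φ s * b s := by
    rw [intervalIntegral.sum_integral_adjacent_intervals
      fun k hk => hφb.mono_set (hsub k hk)]
    simp
  have hsumC : C = ∑ k ∈ Finset.range (n + 1),
      ∫ s in partitionPoint T n k..partitionPoint T n (k + 1), |φ s| := by
    rw [intervalIntegral.sum_integral_adjacent_intervals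
      fun k hk => hφ.abs.mono_set (hsub k hk)]
    simp [hC]
  rw [Real.dist_eq, hsum, ← Finset.sum_sub_distrib]
  calc _ ≤ ∑ k ∈ Finset.range (n + 1), ε / (C + 1) *
        ∫ s in partitionPoint T n k..partitionPoint T n (k + 1), |φ s| := by
        refine (Finset.abs_sum_le_sum_abs _ _).trans (Finset.sum_le_sum fun k hk => ?_)
        have hk := Finset.mem_range.1 hk
        rw [← intervalIntegral.integral_const_mul, ← intervalIntegral.integral_const_mul,
          ← intervalIntegral.integral_sub ((hφ.mono_set (hsub k hk)).const_mul _)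
            (hφb.mono_set (hsub k hk)), ← Real.norm_eq_abs]
        refine intervalIntegral.norm_integral_le_of_norm_le (hmono k.le_succ) ?_
          ((hφ.abs.mono_set (hsub k hk)).const_mul _)
        refine ae_of_all _ fun s hs => ?_
        have hξk := hξ n k (Nat.le_of_lt_succ hk)
        have h0 := (partitionPoint_mem_Icc hT hk.le).1
        have h1 := (partitionPoint_mem_Icc hT hk).2
        have hlen := partitionPoint_succ_sub T n k
        have hd : dist (b (ξ n k)) (b s) < ε / (C + 1) := by
          refine hδb _ ⟨h0.trans hξk.1, hξk.2.trans h1⟩ _ ⟨h0.trans hs.1.le, hs.2.trans h1⟩ ?_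
          refine lt_of_le_of_lt ?_ (hN n hn)
          rw [Real.dist_eq, abs_le]
          constructor <;> linarith [hξk.1, hξk.2, hs.1, hs.2]
        rw [Real.dist_eq] at hd
        rw [show b (ξ n k) * φ s - φ s * b s = (b (ξ n k) - b s) * φ s by ring, norm_mul,
          Real.norm_eq_abs, Real.norm_eq_abs]
        gcongr
    _ = ε / (C + 1) * C := by rw [← Finset.mul_sum, ← hsumC]
    _ < ε := by
        rw [div_mul_eq_mul_div, div_lt_iff₀ (by positivity)]
        nlinarith

/-- Summation by parts. -/
lemma sum_mul_sub_eq_sub_sum (f b : ℕ → ℝ) (n : ℕ) :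
    ∑ k ∈ Finset.range n, f k * (b (k + 1) - b k)
      = f n * b n - f 0 * b 0 + ∑ k ∈ Finset.range n, b (k + 1) * (f k - f (k + 1)) := by
  induction n with
  | zero => simp
  | succ n ih => rw [Finset.sum_range_succ, Finset.sum_range_succ, ih]; ring

lemma intervalIntegrable_sub_rpow {r : ℝ} (hr : -1 < r) (T u v : ℝ) :
    IntervalIntegrable (fun s => (T - s) ^ r) volume u v := by
  simpa using
    (intervalIntegral.intervalIntegrable_rpow' (a := T - u) (b := T - v) hr).comp_sub_left T

lemma integral_sub_rpow_sub_one {a : ℝ} (ha : 0 < a) (T u v : ℝ) :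
    ∫ s in u..v, (T - s) ^ (a - 1) = ((T - u) ^ a - (T - v) ^ a) / a := by
  rw [intervalIntegral.integral_comp_sub_left (fun x => x ^ (a - 1)) T,
    integral_rpow (Or.inl (by linarith))]
  simp

/-- Partial sums of weighted increments of a Wiener process are centred Gaussian. -/
lemma IsStandardWiener.map_sum_increments {P : Measure Ω} [IsProbabilityMeasure P]
    {B : ℝ → Ω → ℝ} (hB : IsStandardWiener P B) (c : ℕ → ℝ) {t : ℕ → ℝ} (ht0 : 0 ≤ t 0)
    (ht : Monotone t) (n : ℕ) :
    P.map (fun ω => ∑ k ∈ Finset.range n, c k * (B (t (k + 1)) ω - B (t k) ω))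
      = gaussianReal 0 (∑ k ∈ Finset.range n, c k ^ 2 * (t (k + 1) - t k)).toNNReal := by
  induction n with
  | zero => simp
  | succ n ih =>
    have htn : 0 ≤ t n := ht0.trans (ht n.zero_le)
    have hstep : t n ≤ t (n + 1) := ht n.le_succ
    have hincr : Measurable fun ω => B (t (n + 1)) ω - B (t n) ω := (hB.meas _).sub (hB.meas _)
    have hlaw : P.map (fun ω => c n * (B (t (n + 1)) ω - B (t n) ω))
        = gaussianReal 0 (c n ^ 2 * (t (n + 1) - t n)).toNNReal := by
      have hcomp : (fun ω => c n * (B (t (n + 1)) ω - B (t n) ω))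
          = (fun x => c n * x) ∘ fun ω => B (t (n + 1)) ω - B (t n) ω := rfl
      rw [hcomp, ← Measure.map_map (by fun_prop) hincr, hB.incr_law _ _ htn hstep,
        gaussianReal_map_const_mul, mul_zero, Real.toNNReal_mul (sq_nonneg _),
        Real.toNNReal_of_nonneg (sq_nonneg (c n))]
    let past : (Icc (0 : ℝ) (t n) → ℝ) → ℝ := fun h => ∑ k ∈ Finset.range n,
      c k * (h (projIcc 0 (t n) htn (t (k + 1))) - h (projIcc 0 (t n) htn (t k)))
    have hpast : Measurable past := by fun_prop
    have hproj : ∀ k ≤ n, (projIcc 0 (t n) htn (t k) : ℝ) = t k := fun k hk => by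
      rw [projIcc_of_mem htn ⟨ht0.trans (ht k.zero_le), ht hk⟩]
    have hpast_eq : (past ∘ fun ω (u : Icc (0 : ℝ) (t n)) => B u.1 ω)
        = fun ω => ∑ k ∈ Finset.range n, c k * (B (t (k + 1)) ω - B (t k) ω) := by
      ext ω
      refine Finset.sum_congr rfl fun k hk => ?_
      have hk := Finset.mem_range.1 hk
      simp only [hproj k hk.le, hproj (k + 1) hk]
    have hindep := ((hB.incr_indep _ _ htn hstep).comp
      (φ := fun x => c n * x) (by fun_prop) hpast).symm
    rw [hpast_eq] at hindep
    have hsum := gaussianReal_add_gaussianReal_of_indepFun hindep ih hlaw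
    rw [add_zero, ← Real.toNNReal_add (Finset.sum_nonneg fun k _ =>
      mul_nonneg (sq_nonneg _) (sub_nonneg.2 (ht k.le_succ)))
      (mul_nonneg (sq_nonneg _) (sub_nonneg.2 hstep))] at hsum
    rw [Finset.sum_range_succ, ← hsum]
    congr 1
    ext ω
    simp [Finset.sum_range_succ]

/-- An almost sure limit of centred Gaussian variables with convergent variances is Gaussian. -/
lemma map_eq_gaussianReal_of_tendsto {P : Measure Ω} [IsProbabilityMeasure P]
    {X : ℕ → Ω → ℝ} {Y : Ω → ℝ} {v : ℕ → ℝ≥0} {w : ℝ≥0} (hX : ∀ n, AEMeasurable (X n) P)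
    (hlaw : ∀ n, P.map (X n) = gaussianReal 0 (v n)) (hv : Tendsto v atTop (𝓝 w))
    (hY : ∀ᵐ ω ∂P, Tendsto (fun n => X n ω) atTop (𝓝 (Y ω))) :
    P.map Y = gaussianReal 0 w := by
  have hYm : AEMeasurable Y P := aemeasurable_of_tendsto_metrizable_ae' hX hY
  have : IsProbabilityMeasure (P.map Y) := Measure.isProbabilityMeasure_map hYm
  refine Measure.ext_of_charFun (funext fun u => ?_)
  have hchar : ∀ {Z : Ω → ℝ}, AEMeasurable Z P →
      charFun (P.map Z) u = ∫ ω, Complex.exp (u * Z ω * Complex.I) ∂P := fun hZ => by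
    rw [charFun_apply_real, integral_map hZ (by fun_prop)]
  have hlim : Tendsto (fun n => charFun (P.map (X n)) u) atTop (𝓝 (charFun (P.map Y) u)) := by
    rw [hchar hYm]
    simp_rw [fun n => hchar (hX n)]
    refine tendsto_integral_of_dominated_convergence (fun _ => 1) (fun n => ?_)
      (integrable_const _) (fun n => ae_of_all _ fun ω => ?_) ?_
    · have := hX n
      exact AEMeasurable.aestronglyMeasurable (by fun_prop)
    · rw [← Complex.ofReal_mul, Complex.norm_exp_ofReal_mul_I]
    · filter_upwards [hY] with ω hω
      have hcont : Continuous fun x : ℝ => Complex.exp (u * x * Complex.I) := by fun_prop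
      exact (hcont.tendsto _).comp hω
  refine tendsto_nhds_unique hlim ?_
  simp_rw [hlaw, charFun_gaussianReal]
  have hcont : Continuous fun x : ℝ≥0 =>
      Complex.exp (u * (0 : ℝ) * Complex.I - ((x : ℝ) : ℂ) * u ^ 2 / 2) := by fun_prop
  exact (hcont.tendsto w).comp hv

lemma gaussianReal_zero_Iio_eq_Ioi (v : ℝ≥0) :
    gaussianReal 0 v (Iio 0) = gaussianReal 0 v (Ioi 0) := by
  conv_lhs =>
    rw [← neg_zero, ← gaussianReal_map_neg, Measure.map_apply (by fun_prop) measurableSet_Iio]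
  congr 1
  ext x
  simp

/-- The integral `∫₀ᵀ (T - s)^(a - 1) B_s ds` is a nondegenerate centred Gaussian variable. -/
lemma IsStandardWiener.exists_map_integral_eq_gaussianReal {P : Measure Ω}
    [IsProbabilityMeasure P] {B : ℝ → Ω → ℝ} (hB : IsStandardWiener P B) {T a : ℝ}
    (hT : 0 < T) (ha : 0 < a) :
    ∃ v : ℝ≥0, v ≠ 0 ∧
      AEMeasurable (fun ω => ∫ s in (0 : ℝ)..T, (T - s) ^ (a - 1) * B s ω) P ∧
      P.map (fun ω => ∫ s in (0 : ℝ)..T, (T - s) ^ (a - 1) * B s ω) = gaussianReal 0 v := by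
  have hcont : Continuous fun s : ℝ => ((T - s) ^ a / a) ^ 2 :=
    (((continuous_const.sub continuous_id).rpow_const fun _ => Or.inr ha.le).div_const a).pow 2
  let S : ℕ → Ω → ℝ := fun n ω => ∑ k ∈ Finset.range (n + 1), (T - partitionPoint T n k) ^ a / a *
    (B (partitionPoint T n (k + 1)) ω - B (partitionPoint T n k) ω)
  have hS : ∀ n, AEMeasurable (S n) P := fun n =>
    (Finset.measurable_fun_sum _ fun k _ =>
      ((hB.meas _).sub (hB.meas _)).const_mul _).aemeasurable
  have hlim : ∀ᵐ ω ∂P, Tendsto (fun n => S n ω) atTop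
      (𝓝 (∫ s in (0 : ℝ)..T, (T - s) ^ (a - 1) * B s ω)) := by
    filter_upwards [hB.init, hB.cont] with ω h0 hc
    refine (tendsto_sum_mul_integral_partition hT.le
      (intervalIntegrable_sub_rpow (r := a - 1) (by linarith) T 0 T) hc
      (ξ := fun n k => partitionPoint T n (k + 1)) fun n k _ =>
        ⟨partitionPoint_mono hT.le n k.le_succ, le_rfl⟩).congr fun n => ?_
    simp only [S]
    rw [sum_mul_sub_eq_sub_sum (fun k => (T - partitionPoint T n k) ^ a / a)
      (fun k => B (partitionPoint T n k) ω)]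
    simp only [partitionPoint_zero, partitionPoint_last, h0, sub_self, Real.zero_rpow ha.ne',
      integral_sub_rpow_sub_one ha, zero_div, zero_mul, mul_zero, zero_add, sub_div]
  have hvar := tendsto_sum_mul_integral_partition hT.le
    (intervalIntegrable_const (c := (1 : ℝ))) hcont
    (ξ := fun n k => partitionPoint T n k) fun n k _ =>
        ⟨le_rfl, partitionPoint_mono hT.le n k.le_succ⟩
  simp only [intervalIntegral.integral_const, smul_eq_mul, mul_one, one_mul] at hvar
  refine ⟨_, ?_, aemeasurable_of_tendsto_metrizable_ae' hS hlim,
    map_eq_gaussianReal_of_tendsto hS (fun n => hB.map_sum_increments _ (by simp)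
      (partitionPoint_mono hT.le n) (n + 1)) ((continuous_real_toNNReal.tendsto _).comp hvar) hlim⟩
  refine (Real.toNNReal_pos.2 (intervalIntegral.intervalIntegral_pos_of_pos_on
    (hcont.intervalIntegrable _ _) (fun s hs => ?_) hT)).ne'
  have : 0 < T - s := sub_pos.2 hs.2
  positivity

lemma tendsto_sub_rpow_atTop {T α : ℝ} (hα : α < 0) :
    Tendsto (fun t : ℝ => (T - t) ^ α) (𝓝[<] T) atTop := by
  refine (tendsto_rpow_neg_nhdsGT_zero hα).comp (tendsto_nhdsWithin_iff.2 ⟨?_, ?_⟩)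
  · have h : Continuous fun t : ℝ => T - t := by fun_prop
    simpa using (h.tendsto T).mono_left nhdsWithin_le_nhds
  · filter_upwards [self_mem_nhdsWithin] with t ht
    exact sub_pos.2 (mem_Iio.1 ht)

lemma tendsto_setIntegral_sub_rpow_mul {T r : ℝ} (hT : 0 < T) (hr : -1 < r) {b : ℝ → ℝ}
    (hb : Continuous b) :
    Tendsto (fun t => ∫ s in Ioc (0 : ℝ) t, (T - s) ^ r * b s) (𝓝[<] T)
      (𝓝 (∫ s in (0 : ℝ)..T, (T - s) ^ r * b s)) := by
  have hint := ((intervalIntegrable_sub_rpow hr T 0 T).mul_continuousOn hb.continuousOn)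
  rw [intervalIntegrable_iff_integrableOn_Icc_of_le hT.le] at hint
  rw [intervalIntegral.integral_of_le hT.le]
  have h := intervalIntegral.continuousOn_primitive hint T (right_mem_Icc.2 hT.le)
  refine Tendsto.mono_left h ?_
  rw [← nhdsWithin_Ioo_eq_nhdsLT hT]
  exact nhdsWithin_mono _ Ioo_subset_Icc_self

lemma tendsto_alphaWienerBridge_atTop {Ω₀ : Type*} {T α : ℝ} (hT : 0 < T) (hα : α < 0)
    {B : ℝ → Ω₀ → ℝ} {ω : Ω₀} (hc : Continuous fun t => B t ω)
    (hpos : 0 < ∫ s in (0 : ℝ)..T, (T - s) ^ (-α - 1) * B s ω) :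
    Tendsto (fun t => alphaWienerBridge T α B t ω) (𝓝[<] T) atTop := by
  have h := ((tendsto_sub_rpow_atTop (T := T) hα).const_mul_atTop (neg_pos.2 hα)).atTop_mul_pos hpos
    (tendsto_setIntegral_sub_rpow_mul hT (r := -α - 1) (by linarith) hc)
  refine (((hc.tendsto T).mono_left nhdsWithin_le_nhds).add_atTop h).congr fun t => ?_
  simp only [alphaWienerBridge]
  ring

lemma alphaWienerBridge_neg {Ω₀ : Type*} (T α : ℝ) (B : ℝ → Ω₀ → ℝ) (t : ℝ) (ω : Ω₀) :
    alphaWienerBridge T α (fun s ω => -B s ω) t ω = -alphaWienerBridge T α B t ω := by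
  simp only [alphaWienerBridge, mul_neg, integral_neg]
  ring

lemma tendsto_alphaWienerBridge_atBot {Ω₀ : Type*} {T α : ℝ} (hT : 0 < T) (hα : α < 0)
    {B : ℝ → Ω₀ → ℝ} {ω : Ω₀} (hc : Continuous fun t => B t ω)
    (hneg : ∫ s in (0 : ℝ)..T, (T - s) ^ (-α - 1) * B s ω < 0) :
    Tendsto (fun t => alphaWienerBridge T α B t ω) (𝓝[<] T) atBot := by
  rw [← tendsto_neg_atTop_iff]
  simp only [← alphaWienerBridge_neg]
  refine tendsto_alphaWienerBridge_atTop hT hα hc.neg ?_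
  simpa only [mul_neg, intervalIntegral.integral_neg, neg_pos] using hneg

/-- For `α < 0` the events `{lim_{t↑T} X^{(α)}_t = −∞}` and
`{lim_{t↑T} X^{(α)}_t = ∞}` each have probability `1/2`; consequently there is no almost surely
continuous process `(Y^{(α)}_t)_{t∈[0,T]}` with `P(X^{(α)}_t = Y^{(α)}_t) = 1` for all
`t ∈ [0,T)`. -/
theorem alphaWienerBridge_no_continuous_extension_of_neg
    (P : Measure Ω) [IsProbabilityMeasure P]
    (T α : ℝ) (hT : 0 < T) (hα : α < 0) (B : ℝ → Ω → ℝ) (hB : IsStandardWiener P B) :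
    P {ω | Tendsto (fun t => alphaWienerBridge T α B t ω) (𝓝[<] T) atBot} = 1/2 ∧
    P {ω | Tendsto (fun t => alphaWienerBridge T α B t ω) (𝓝[<] T) atTop} = 1/2 ∧
    ¬ ∃ Y : ℝ → Ω → ℝ,
        (∀ᵐ ω ∂P, ContinuousOn (fun t => Y t ω) (Set.Icc 0 T)) ∧
        ∀ t ∈ Set.Ico (0:ℝ) T, ∀ᵐ ω ∂P, alphaWienerBridge T α B t ω = Y t ω := by
  obtain ⟨v, hv, hIm, hI⟩ := hB.exists_map_integral_eq_gaussianReal hT (neg_pos.2 hα)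
  set I : Ω → ℝ := fun ω => ∫ s in (0 : ℝ)..T, (T - s) ^ (-α - 1) * B s ω with hIdef
  have hne : ∀ᵐ ω ∂P, I ω ≠ 0 := by
    have := nullSingletonClass_gaussianReal (μ := 0) hv
    refine ae_of_ae_map (p := fun x : ℝ => x ≠ 0) hIm ?_
    rw [hI]
    exact ae_iff.2 (by simp)
  have htop : ∀ᵐ ω ∂P, (Tendsto (fun t => alphaWienerBridge T α B t ω) (𝓝[<] T) atTop ↔
      0 < I ω) := by
    filter_upwards [hne, hB.cont] with ω h0 hc
    refine ⟨fun h => ?_, tendsto_alphaWienerBridge_atTop hT hα hc⟩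
    refine h0.lt_or_gt.resolve_left fun hlt => ?_
    exact (tendsto_alphaWienerBridge_atBot hT hα hc hlt).not_tendsto disjoint_atBot_atTop h
  have hbot : ∀ᵐ ω ∂P, (Tendsto (fun t => alphaWienerBridge T α B t ω) (𝓝[<] T) atBot ↔
      I ω < 0) := by
    filter_upwards [hne, hB.cont] with ω h0 hc
    refine ⟨fun h => ?_, tendsto_alphaWienerBridge_atBot hT hα hc⟩
    refine h0.lt_or_gt.resolve_right fun hgt => ?_
    exact (tendsto_alphaWienerBridge_atTop hT hα hc hgt).not_tendsto disjoint_atTop_atBot h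
  refine ⟨?_, ?_, ?_⟩
  · have hset : {ω | Tendsto (fun t => alphaWienerBridge T α B t ω) (𝓝[<] T) atBot}
        =ᵐ[P] I ⁻¹' Iio 0 := eventuallyEq_set.2 hbot
    rw [measure_congr hset, ← Measure.map_apply_of_aemeasurable hIm measurableSet_Iio, hI,
      gaussianReal_zero_Iio_eq_Ioi, gaussianReal_zero_Ioi hv]
  · have hset : {ω | Tendsto (fun t => alphaWienerBridge T α B t ω) (𝓝[<] T) atTop}
        =ᵐ[P] I ⁻¹' Ioi 0 := eventuallyEq_set.2 htop
    rw [measure_congr hset, ← Measure.map_apply_of_aemeasurable hIm measurableSet_Ioi, hI,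
      gaussianReal_zero_Ioi hv]
  · rintro ⟨Y, hYc, hXY⟩
    obtain ⟨u, -, hu, hulim⟩ := exists_seq_strictMono_tendsto' hT
    have huW : Tendsto u atTop (𝓝[<] T) :=
      tendsto_nhdsWithin_iff.2 ⟨hulim, Eventually.of_forall fun n => (hu n).2⟩
    have hfalse : ∀ᵐ _ω ∂P, False := by
      filter_upwards [hYc, ae_all_iff.2 fun n => hXY (u n) ⟨(hu n).1.le, (hu n).2⟩, hne, htop,
        hbot] with ω hc hXu h0 h1 h2
      have hYT : Tendsto (fun n => alphaWienerBridge T α B (u n) ω) atTop (𝓝 (Y T ω)) := by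
        simp only [hXu]
        exact (hc T (right_mem_Icc.2 hT.le)).tendsto.comp (tendsto_nhdsWithin_iff.2
          ⟨hulim, Eventually.of_forall fun n => Ioo_subset_Icc_self (hu n)⟩)
      rcases h0.lt_or_gt with hlt | hgt
      · exact not_tendsto_nhds_of_tendsto_atBot ((h2.2 hlt).comp huW) _ hYT
      · exact not_tendsto_nhds_of_tendsto_atTop ((h1.2 hgt).comp huW) _ hYT
    exact hfalse.exists.elim fun _ h => h
end
end

section
/- For every α ∈ ℝ one has P( lim_{t↑T} ∫₀ᵗ (X^{(α)}_u)²/(T−u)² du = ∞ ) = 1. -/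
open MeasureTheory ProbabilityTheory Filter Set Topology
open scoped ENNReal NNReal

noncomputable section

variable {Ω : Type*} [MeasurableSpace Ω]

lemma gaussianReal_zero_abs_lt_le {v : ℝ≥0} (hv : v ≠ 0) {ε : ℝ} (hε : 0 ≤ ε) :
    gaussianReal 0 v {x | |x| < ε * √v} ≤ ENNReal.ofReal ε := by
  have hv' : (0 : ℝ) < v := by positivity
  have hset : {x : ℝ | |x| < ε * √v} = Ioo (-(ε * √v)) (ε * √v) := by
    ext x; simp [abs_lt]
  rw [hset, gaussianReal_apply _ hv]
  calc ∫⁻ x in Ioo (-(ε * √v)) (ε * √v), gaussianPDF 0 v x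
      ≤ ∫⁻ x in Ioo (-(ε * √v)) (ε * √v), ENNReal.ofReal (√(2 * Real.pi * v))⁻¹ := by
        refine lintegral_mono fun x => ENNReal.ofReal_le_ofReal ?_
        rw [gaussianPDFReal]
        refine mul_le_of_le_one_right (by positivity) (Real.exp_le_one_iff.mpr ?_)
        rw [neg_div]
        exact neg_nonpos.mpr (by positivity)
    _ = ENNReal.ofReal ((√(2 * Real.pi * v))⁻¹ * (2 * (ε * √v))) := by
        rw [lintegral_const, Measure.restrict_apply_univ, Real.volume_Ioo,
          ← ENNReal.ofReal_mul (by positivity)]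
        ring_nf
    _ ≤ ENNReal.ofReal ε := by
        refine ENNReal.ofReal_le_ofReal ?_
        have h2 : 2 ≤ √(2 * Real.pi) := Real.le_sqrt_of_sq_le (by linarith [Real.pi_gt_three])
        have hs : 0 < √(v : ℝ) := by positivity
        rw [Real.sqrt_mul (by positivity), inv_mul_le_iff₀ (by positivity)]
        nlinarith [mul_nonneg hε hs.le]

/-- Anti-concentration: the mean over an interval of length `h` of the absolute increments
`|W (t + h) - W t|` is unlikely to be small compared with `√h`. -/
lemma measure_lintegral_abs_increment_le {P : Measure Ω} [IsProbabilityMeasure P]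
    {W : ℝ → Ω → ℝ} (hW : ∀ t, Measurable (W t)) (hc : ∀ ω, Continuous fun t => W t ω)
    {a h ε : ℝ} (hh : 0 < h) (hε : 0 < ε)
    (hlaw : ∀ t ∈ Ioc a (a + h),
      P.map (fun ω => W (t + h) ω - W t ω) = gaussianReal 0 h.toNNReal) :
    P {ω | ∫⁻ t in Ioc a (a + h), ENNReal.ofReal |W (t + h) ω - W t ω| ≤
      ENNReal.ofReal (ε / 2 * (h * √h))} ≤ ENNReal.ofReal (2 * ε) := by
  have hWm : Measurable fun p : Ω × ℝ => W p.2 p.1 :=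
    measurable_uncurry_of_continuous_of_measurable (u := W) hc hW |>.comp measurable_swap
  have hN : Measurable fun p : Ω × ℝ => ENNReal.ofReal |W (p.2 + h) p.1 - W p.2 p.1| := by
    have h1 : Measurable fun p : Ω × ℝ => W (p.2 + h) p.1 :=
      hWm.comp (measurable_fst.prodMk (measurable_snd.add_const h))
    exact ((h1.sub hWm).norm).ennreal_ofReal
  set A : Set Ω := {ω | ∫⁻ t in Ioc a (a + h), ENNReal.ofReal |W (t + h) ω - W t ω| ≤
      ENNReal.ofReal (ε / 2 * (h * √h))} with hA
  have hAm : MeasurableSet A := by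
    have := hN.lintegral_prod_right' (ν := volume.restrict (Ioc a (a + h)))
    exact measurableSet_le this measurable_const
  set c : ℝ≥0∞ := ENNReal.ofReal (ε * √h) with hc'
  have key : ∀ t ∈ Ioc a (a + h),
      c * P A ≤ ∫⁻ ω in A, ENNReal.ofReal |W (t + h) ω - W t ω| ∂P + c * ENNReal.ofReal ε := by
    intro t ht
    have hd : Measurable fun ω => W (t + h) ω - W t ω := (hW _).sub (hW _)
    have hsmall : P {ω | |W (t + h) ω - W t ω| < ε * √h} ≤ ENNReal.ofReal ε := by
      have := gaussianReal_zero_abs_lt_le (v := h.toNNReal)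
        (by simpa using hh) hε.le
      rw [← hlaw t ht, Measure.map_apply hd (measurableSet_lt (by fun_prop) (by fun_prop)),
        Real.coe_toNNReal _ hh.le] at this
      exact this
    have hbig : c * P (A ∩ {ω | |W (t + h) ω - W t ω| < ε * √h}ᶜ) ≤
        ∫⁻ ω in A, ENNReal.ofReal |W (t + h) ω - W t ω| ∂P := by
      refine le_trans ?_ (lintegral_mono_set (s := A ∩ {ω | |W (t + h) ω - W t ω| < ε * √h}ᶜ)
        inter_subset_left)
      rw [← setLIntegral_const]
      have hm : MeasurableSet {ω | |W (t + h) ω - W t ω| < ε * √h} :=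
        measurableSet_lt hd.norm measurable_const
      refine setLIntegral_mono' (hAm.inter hm.compl) fun ω hω => ?_
      exact ENNReal.ofReal_le_ofReal (not_lt.mp hω.2)
    calc c * P A ≤ c * (P (A ∩ {ω | |W (t + h) ω - W t ω| < ε * √h}ᶜ) +
          P {ω | |W (t + h) ω - W t ω| < ε * √h}) := by
          gcongr
          refine (measure_mono fun ω hω => ?_).trans (measure_union_le _ _)
          by_cases hx : |W (t + h) ω - W t ω| < ε * √h
          · exact Or.inr hx
          · exact Or.inl ⟨hω, hx⟩
      _ ≤ _ := by
          rw [mul_add]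
          gcongr
  have hvol : volume (Ioc a (a + h)) = ENNReal.ofReal h := by simp
  have hint : c * P A * ENNReal.ofReal h ≤
      ENNReal.ofReal (ε / 2 * (h * √h)) * P A + c * ENNReal.ofReal ε * ENNReal.ofReal h := by
    calc c * P A * ENNReal.ofReal h = ∫⁻ t in Ioc a (a + h), c * P A := by
          rw [setLIntegral_const, hvol]
      _ ≤ ∫⁻ t in Ioc a (a + h),
          (∫⁻ ω in A, ENNReal.ofReal |W (t + h) ω - W t ω| ∂P + c * ENNReal.ofReal ε) :=
          setLIntegral_mono' measurableSet_Ioc key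
      _ = (∫⁻ ω in A, (∫⁻ t in Ioc a (a + h), ENNReal.ofReal |W (t + h) ω - W t ω|) ∂P) +
          c * ENNReal.ofReal ε * ENNReal.ofReal h := by
          rw [lintegral_add_right _ measurable_const, setLIntegral_const, hvol,
            lintegral_lintegral_swap]
          exact (hN.comp measurable_swap).aemeasurable
      _ ≤ _ := by
          gcongr
          rw [← setLIntegral_const]
          exact setLIntegral_mono' hAm fun ω hω => hω
  have hp : P A = ENNReal.ofReal (P.real A) := by simp [Measure.real]
  rw [hp] at hint ⊢
  have hp0 : 0 ≤ P.real A := measureReal_nonneg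
  have hs : 0 < √h := Real.sqrt_pos.mpr hh
  rw [hc', ← ENNReal.ofReal_mul (by positivity), ← ENNReal.ofReal_mul (by positivity),
    ← ENNReal.ofReal_mul (by positivity), ← ENNReal.ofReal_mul (by positivity),
    ← ENNReal.ofReal_mul (by positivity), ← ENNReal.ofReal_add (by positivity) (by positivity),
    ENNReal.ofReal_le_ofReal_iff (by positivity)] at hint
  refine ENNReal.ofReal_le_ofReal ?_
  have hpos : 0 < ε * √h * h := by positivity
  have : ε * √h * h * P.real A ≤ ε * √h * h * (2 * ε) := by nlinarith
  exact le_of_mul_le_mul_left this hpos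

lemma monotoneOn_intervalIntegral_sq {Y : ℝ → ℝ} {T : ℝ} (hT : 0 < T)
    (hY : ContinuousOn Y (Iio T)) :
    MonotoneOn (fun t => ∫ u in (0:ℝ)..t, Y u ^ 2) (Iio T) := by
  have hint : ∀ s ∈ Iio T, ∀ t ∈ Iio T, IntervalIntegrable (fun u => Y u ^ 2) volume s t :=
    fun s hs t ht => ((hY.pow 2).mono (ordConnected_Iio.uIcc_subset hs ht)).intervalIntegrable
  intro s hs t ht hst
  have h0 : (0 : ℝ) ∈ Iio T := hT
  rw [← sub_nonneg, intervalIntegral.integral_interval_sub_left (hint 0 h0 t ht) (hint 0 h0 s hs)]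
  exact intervalIntegral.integral_nonneg hst fun u _ => sq_nonneg _

lemma tendsto_atTop_or_exists_tendsto_nhdsLT {f : ℝ → ℝ} {T : ℝ} (hf : MonotoneOn f (Iio T)) :
    Tendsto f (𝓝[<] T) atTop ∨ ∃ l, Tendsto f (𝓝[<] T) (𝓝 l) := by
  by_cases hb : BddAbove (f '' Iio T)
  · exact Or.inr ⟨_, hf.tendsto_nhdsLT hb⟩
  · refine Or.inl (tendsto_atTop.mpr fun c => ?_)
    obtain ⟨_, ⟨s, hs, rfl⟩, hcs⟩ := not_bddAbove_iff.mp hb c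
    filter_upwards [Ioo_mem_nhdsLT hs] with t ht
    exact hcs.le.trans (hf hs ht.2 ht.1.le)

lemma integral_abs_increment_le {b Y K : ℝ → ℝ} {T α h : ℝ} (hh : 0 < h)
    (hb : Continuous b) (hY : ContinuousOn Y (Iio T)) (hK : ∀ t < T, HasDerivAt K (Y t) t)
    (hbY : ∀ t < T, b t = (T - t) * Y t + α * K t) :
    ∫ t in (T - 3 * h)..(T - 2 * h), |b (t + h) - b t| ≤
      (5 + |α|) * h * ∫ t in (T - 3 * h)..(T - h), |Y t| := by
  have hint : ∀ s < T, ∀ t < T, IntervalIntegrable (fun u => |Y u|) volume s t :=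
    fun s hs t ht => (hY.abs.mono (ordConnected_Iio.uIcc_subset hs ht)).intervalIntegrable
  set I := ∫ t in (T - 3 * h)..(T - h), |Y t| with hI
  have hsub : ∀ s t, T - 3 * h ≤ s → s ≤ t → t ≤ T - h → ∫ u in s..t, |Y u| ≤ I := by
    intro s t hs hst ht
    exact intervalIntegral.integral_mono_interval hs hst ht (ae_of_all _ fun _ => abs_nonneg _)
      (hint _ (by linarith) _ (by linarith))
  have hpt : ∀ t ∈ Icc (T - 3 * h) (T - 2 * h),
      |b (t + h) - b t| ≤ 2 * h * |Y (t + h)| + 3 * h * |Y t| + |α| * I := by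
    rintro t ⟨ht1, ht2⟩
    have hKd : K (t + h) - K t = ∫ u in t..(t + h), Y u := by
      refine (intervalIntegral.integral_eq_sub_of_hasDerivAt (fun u hu => hK u ?_) ?_).symm
      · rw [uIcc_of_le (by linarith)] at hu
        linarith [hu.2]
      · exact (hY.mono (ordConnected_Iio.uIcc_subset (show t < T by linarith)
          (show t + h < T by linarith))).intervalIntegrable
    have hKb : |K (t + h) - K t| ≤ I := by
      rw [hKd]
      exact (intervalIntegral.abs_integral_le_integral_abs (by linarith)).trans
        (hsub t (t + h) ht1 (by linarith) (by linarith))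
    have heq : b (t + h) - b t =
        (T - (t + h)) * Y (t + h) + -((T - t) * Y t) + α * (K (t + h) - K t) := by
      rw [hbY t (by linarith), hbY (t + h) (by linarith)]
      ring
    rw [heq]
    refine (abs_add_three _ _ _).trans ?_
    rw [abs_neg, abs_mul, abs_mul, abs_mul, abs_of_nonneg (show 0 ≤ T - (t + h) by linarith),
      abs_of_nonneg (show 0 ≤ T - t by linarith)]
    gcongr <;> linarith
  have hi1 : IntervalIntegrable (fun t => |Y (t + h)|) volume (T - 3 * h) (T - 2 * h) := by
    have := (hint (T - 2 * h) (by linarith) (T - h) (by linarith)).comp_add_right h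
    convert this using 1 <;> ring
  have hi2 := hint (T - 3 * h) (by linarith) (T - 2 * h) (by linarith)
  calc ∫ t in (T - 3 * h)..(T - 2 * h), |b (t + h) - b t|
      ≤ ∫ t in (T - 3 * h)..(T - 2 * h), (2 * h * |Y (t + h)| + 3 * h * |Y t| + |α| * I) := by
        refine intervalIntegral.integral_mono_on (by linarith) ?_ ?_ hpt
        · exact Continuous.intervalIntegrable (by fun_prop) _ _
        · exact ((hi1.const_mul _).add (hi2.const_mul _)).add intervalIntegrable_const
    _ = 2 * h * (∫ t in (T - 2 * h)..(T - h), |Y t|) +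
        3 * h * (∫ t in (T - 3 * h)..(T - 2 * h), |Y t|) + h * (|α| * I) := by
        rw [intervalIntegral.integral_add ((hi1.const_mul _).add (hi2.const_mul _))
          intervalIntegrable_const, intervalIntegral.integral_add (hi1.const_mul _)
          (hi2.const_mul _), intervalIntegral.integral_const_mul,
          intervalIntegral.integral_const_mul, intervalIntegral.integral_const,
          intervalIntegral.integral_comp_add_right (fun t => |Y t|), smul_eq_mul]
        congr 3 <;> ring_nf
    _ ≤ 2 * h * I + 3 * h * I + h * (|α| * I) := by
        gcongr
        · exact hsub _ _ (by linarith) (by linarith) le_rfl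
        · exact hsub _ _ le_rfl (by linarith) (by linarith)
    _ = (5 + |α|) * h * I := by ring

lemma two_mul_mul_integral_abs_le {Y : ℝ → ℝ} {p q : ℝ} (hpq : p ≤ q)
    (hY : ContinuousOn Y (Icc p q)) (a : ℝ) :
    2 * a * ∫ t in p..q, |Y t| ≤ (q - p) * a ^ 2 + ∫ t in p..q, Y t ^ 2 := by
  rw [← uIcc_of_le hpq] at hY
  have h2 : IntervalIntegrable (fun t => Y t ^ 2) volume p q := (hY.pow 2).intervalIntegrable
  have hconst : (q - p) * a ^ 2 = ∫ _ in p..q, a ^ 2 := by simp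
  rw [hconst, ← intervalIntegral.integral_const_mul,
    ← intervalIntegral.integral_add intervalIntegrable_const h2]
  refine intervalIntegral.integral_mono_on hpq (hY.abs.intervalIntegrable.const_mul _)
    (intervalIntegrable_const.add h2) fun t _ => ?_
  nlinarith [sq_nonneg (a - |Y t|), sq_abs (Y t)]

lemma eventually_integral_abs_increment_le {b Y K : ℝ → ℝ} {T α l : ℝ} (hT : 0 < T)
    (hb : Continuous b) (hY : ContinuousOn Y (Iio T)) (hK : ∀ t < T, HasDerivAt K (Y t) t)
    (hbY : ∀ t < T, b t = (T - t) * Y t + α * K t)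
    (hl : Tendsto (fun t => ∫ u in (0:ℝ)..t, Y u ^ 2) (𝓝[<] T) (𝓝 l)) {η : ℝ} (hη : 0 < η) :
    ∀ᶠ h in 𝓝[>] 0, ∫ t in (T - 3 * h)..(T - 2 * h), |b (t + h) - b t| ≤ η * (h * √h) := by
  have hint : ∀ s < T, ∀ t < T, IntervalIntegrable (fun u => Y u ^ 2) volume s t :=
    fun s hs t ht => ((hY.pow 2).mono (ordConnected_Iio.uIcc_subset hs ht)).intervalIntegrable
  have hlim : ∀ c : ℝ, 0 < c → Tendsto (fun h => T - c * h) (𝓝[>] 0) (𝓝[<] T) := by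
    intro c hc
    refine tendsto_nhdsWithin_iff.mpr ⟨?_, ?_⟩
    · have : Continuous fun h : ℝ => T - c * h := by fun_prop
      simpa using (this.tendsto 0).mono_left nhdsWithin_le_nhds
    · filter_upwards [self_mem_nhdsWithin] with h hh
      have : 0 < c * h := mul_pos hc hh
      simpa using this
  have hdiff := (hl.comp (hlim 1 one_pos)).sub (hl.comp (hlim 3 (by norm_num)))
  rw [sub_self] at hdiff
  have hα : 0 < 5 + |α| := by positivity
  obtain ⟨δ, hδ, hδη⟩ : ∃ δ > 0, (5 + |α|) * (2 * δ) = η :=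
    ⟨η / (2 * (5 + |α|)), by positivity, by field_simp⟩
  filter_upwards [hdiff.eventually_lt_const (show (0 : ℝ) < 2 * δ ^ 2 by positivity),
    self_mem_nhdsWithin] with h he (hh : 0 < h)
  simp only [Function.comp_apply, one_mul] at he
  rw [intervalIntegral.integral_interval_sub_left (hint 0 hT _ (by linarith))
    (hint 0 hT _ (by linarith))] at he
  have hs : 0 < √h := Real.sqrt_pos.mpr hh
  have hss : √h ^ 2 = h := Real.sq_sqrt hh.le
  have hcs := two_mul_mul_integral_abs_le (p := T - 3 * h) (q := T - h) (by linarith)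
    (hY.mono fun t ht => lt_of_le_of_lt ht.2 (by linarith)) (δ / √h)
  have h1 : (T - h - (T - 3 * h)) * (δ / √h) ^ 2 = 2 * δ ^ 2 := by
    rw [div_pow, hss]; field_simp; ring
  have hI : ∫ t in (T - 3 * h)..(T - h), |Y t| ≤ 2 * δ * √h := by
    rw [h1] at hcs
    have h2 : 2 * (δ / √h) * ∫ t in (T - 3 * h)..(T - h), |Y t| ≤
        2 * (δ / √h) * (2 * δ * √h) := by
      have : 2 * (δ / √h) * (2 * δ * √h) = 4 * δ ^ 2 := by field_simp; ring
      linarith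
    exact le_of_mul_le_mul_left h2 (by positivity)
  calc _ ≤ _ := integral_abs_increment_le hh hb hY hK hbY
    _ ≤ (5 + |α|) * h * (2 * δ * √h) := by gcongr
    _ = η * (h * √h) := by rw [← hδη]; ring

/-- The path functional `t ↦ (T - t)^α ∫₀ᵗ (T - s)^(-α-1) b s ds`. -/
def weightedPrimitive (T α : ℝ) (b : ℝ → ℝ) (t : ℝ) : ℝ :=
  (T - t) ^ α * ∫ s in (0:ℝ)..t, (T - s) ^ (-α - 1) * b s

lemma hasDerivAt_weightedPrimitive {T α : ℝ} (hT : 0 < T) {b : ℝ → ℝ} (hb : Continuous b)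
    {t : ℝ} (ht : t < T) :
    HasDerivAt (weightedPrimitive T α b) ((b t - α * weightedPrimitive T α b t) / (T - t)) t := by
  have hcont : ContinuousOn (fun s => (T - s) ^ (-α - 1) * b s) (Iio T) := by
    refine ContinuousOn.mul (ContinuousOn.rpow_const (by fun_prop) fun s hs => Or.inl ?_)
      hb.continuousOn
    exact (sub_pos.mpr hs).ne'
  have hA : HasDerivAt (fun t => ∫ s in (0:ℝ)..t, (T - s) ^ (-α - 1) * b s)
      ((T - t) ^ (-α - 1) * b t) t := by
    refine intervalIntegral.integral_hasDerivAt_right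
      ((hcont.mono (ordConnected_Iio.uIcc_subset hT ht)).intervalIntegrable) ?_
      (hcont.continuousAt (Iio_mem_nhds ht))
    exact hcont.stronglyMeasurableAtFilter isOpen_Iio t ht
  have hpos : 0 < T - t := sub_pos.mpr ht
  have hp : HasDerivAt (fun t => (T - t) ^ α) (-1 * α * (T - t) ^ (α - 1)) t :=
    ((hasDerivAt_id t).const_sub T).rpow_const (Or.inl hpos.ne')
  convert! hp.mul hA using 1
  rw [weightedPrimitive, Real.rpow_sub_one hpos.ne', Real.rpow_sub_one hpos.ne',
    Real.rpow_neg hpos.le]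
  have := (Real.rpow_pos_of_pos hpos α).ne'
  field_simp
  ring

/-- If the energy integral does not diverge, then the increments of the driving path near `T` are
small in mean, compared with the Brownian scale. -/
lemma tendsto_energy_atTop_or_eventually_le {Ω' : Type*} {T α : ℝ} (hT : 0 < T)
    {B : ℝ → Ω' → ℝ} {ω : Ω'} (hb : Continuous fun t => B t ω) :
    Tendsto (fun t => ∫ u in Ioc (0:ℝ) t, alphaWienerBridge T α B u ω ^ 2 / (T - u) ^ 2)
      (𝓝[<] T) atTop ∨
    ∀ η > 0, ∀ᶠ h in 𝓝[>] 0,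
      ∫ t in (T - 3 * h)..(T - 2 * h), |B (t + h) ω - B t ω| ≤ η * (h * √h) := by
  set K := weightedPrimitive T α fun t => B t ω with hKdef
  set Y : ℝ → ℝ := fun t => (B t ω - α * K t) / (T - t) with hYdef
  have hK : ∀ t < T, HasDerivAt K (Y t) t := fun t ht => hasDerivAt_weightedPrimitive hT hb ht
  have hY : ContinuousOn Y (Iio T) := by
    refine ContinuousOn.div (hb.continuousOn.sub (continuousOn_const.mul fun t ht =>
      (hK t ht).continuousAt.continuousWithinAt)) (by fun_prop) fun t ht => ?_
    exact (sub_pos.mpr ht).ne'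
  have hbY : ∀ t < T, B t ω = (T - t) * Y t + α * K t := by
    intro t ht
    have := (sub_pos.mpr ht).ne'
    simp only [hYdef]
    field_simp
    ring
  have hen : (fun t => ∫ u in (0:ℝ)..t, Y u ^ 2) =ᶠ[𝓝[<] T]
      fun t => ∫ u in Ioc (0:ℝ) t, alphaWienerBridge T α B u ω ^ 2 / (T - u) ^ 2 := by
    filter_upwards [Ioo_mem_nhdsLT hT] with t ht
    rw [intervalIntegral.integral_of_le ht.1.le]
    refine setIntegral_congr_fun measurableSet_Ioc fun u hu => ?_
    simp only [hYdef, hKdef, weightedPrimitive, alphaWienerBridge,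
      intervalIntegral.integral_of_le hu.1.le, div_pow, mul_assoc]
  rcases tendsto_atTop_or_exists_tendsto_nhdsLT (monotoneOn_intervalIntegral_sq hT hY) with
    h | ⟨l, hl⟩
  · exact Or.inl (h.congr' hen)
  · exact Or.inr fun η hη => eventually_integral_abs_increment_le hT hb hY hK hbY hl hη

lemma IsStandardWiener.exists_continuous_modification {P : Measure Ω} {B : ℝ → Ω → ℝ}
    (hB : IsStandardWiener P B) :
    ∃ W : ℝ → Ω → ℝ, (∀ t, Measurable (W t)) ∧ (∀ ω, Continuous fun t => W t ω) ∧
      ∀ᵐ ω ∂P, ∀ t, W t ω = B t ω := by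
  obtain ⟨N, hN, hNm, hN0⟩ := exists_measurable_superset_of_null (ae_iff.mp hB.cont)
  refine ⟨fun t => Nᶜ.indicator (B t), fun t => (hB.meas t).indicator hNm.compl, fun ω => ?_, ?_⟩
  · by_cases hω : ω ∈ N
    · simpa [hω] using continuous_const
    · have : Continuous fun t => B t ω := by
        by_contra hcon
        exact hω (hN hcon)
      simpa [hω] using this
  · filter_upwards [measure_eq_zero_iff_ae_notMem.mp hN0] with ω hω t
    simp [hω]

lemma IsStandardWiener.ae_not_forall_eventually_integral_abs_increment_le
    {P : Measure Ω} [IsProbabilityMeasure P] {T : ℝ} (hT : 0 < T) {B : ℝ → Ω → ℝ} (hB : IsStandardWiener P B) :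
    ∀ᵐ ω ∂P, ¬ ∀ η > 0, ∀ᶠ h in 𝓝[>] 0,
      ∫ t in (T - 3 * h)..(T - 2 * h), |B (t + h) ω - B t ω| ≤ η * (h * √h) := by
  obtain ⟨W, hWm, hWc, hWB⟩ := hB.exists_continuous_modification
  set h : ℕ → ℝ := fun n => T / (n + 3) with hh
  have hpos : ∀ n, 0 < h n := fun n => by positivity
  have hle : ∀ n, 3 * h n ≤ T := fun n => by
    simp only [hh]
    rw [mul_div_assoc', div_le_iff₀ (by positivity)]
    nlinarith [mul_nonneg hT.le (Nat.cast_nonneg (α := ℝ) n)]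
  have hlim : Tendsto h atTop (𝓝[>] 0) := by
    refine tendsto_nhdsWithin_iff.mpr ⟨?_, Eventually.of_forall hpos⟩
    exact (tendsto_atTop_add_const_right _ _ tendsto_natCast_atTop_atTop).const_div_atTop T
  set E : ℝ → ℕ → Set Ω := fun ε n =>
    {ω | ∫⁻ t in Ioc (T - 3 * h n) (T - 3 * h n + h n),
      ENNReal.ofReal |W (t + h n) ω - W t ω| ≤ ENNReal.ofReal (ε / 2 * (h n * √(h n)))} with hE
  have hEP : ∀ ε > 0, ∀ n, P (E ε n) ≤ ENNReal.ofReal (2 * ε) := by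
    intro ε hε n
    refine measure_lintegral_abs_increment_le hWm hWc (hpos n) hε fun t ht => ?_
    have ht0 : 0 ≤ t := by linarith [ht.1, hle n]
    rw [Measure.map_congr (g := fun ω => B (t + h n) ω - B t ω)
      (by filter_upwards [hWB] with ω hω; rw [hω, hω]),
      hB.incr_law t (t + h n) ht0 (by linarith [hpos n]), add_sub_cancel_left]
  set S : Set Ω := {ω | ∀ η > 0, ∀ᶠ h in 𝓝[>] 0,
      ∫ t in (T - 3 * h)..(T - 2 * h), |W (t + h) ω - W t ω| ≤ η * (h * √h)} with hS
  have hSE : ∀ ε > 0, S ⊆ ⋃ m, ⋂ n ≥ m, E ε n := by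
    intro ε hε ω hω
    obtain ⟨m, hm⟩ := eventually_atTop.mp (hlim.eventually (hω (ε / 2) (by positivity)))
    refine mem_iUnion.mpr ⟨m, mem_iInter₂.mpr fun n hmn => ?_⟩
    have hn := hm n hmn
    have heq : T - 3 * h n + h n = T - 2 * h n := by ring
    have hc : Continuous fun t => |W (t + h n) ω - W t ω| :=
      (((hWc ω).comp (continuous_add_const (h n))).sub (hWc ω)).abs
    simp only [hE, mem_ofPred_eq]
    rw [heq, ← ofReal_integral_eq_lintegral_ofReal
      (hc.integrableOn_Ioc) (ae_of_all _ fun _ => abs_nonneg _),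
      ← intervalIntegral.integral_of_le (by linarith [hpos n])]
    exact ENNReal.ofReal_le_ofReal hn
  have hS0 : P S = 0 := by
    refine le_antisymm (ge_of_tendsto (x := 𝓝[>] (0 : ℝ))
      (f := fun ε => ENNReal.ofReal (2 * ε)) ?_ ?_) zero_le
    · have : Continuous fun ε : ℝ => ENNReal.ofReal (2 * ε) :=
        ENNReal.continuous_ofReal.comp (continuous_const_mul 2)
      simpa using (this.tendsto 0).mono_left nhdsWithin_le_nhds
    · filter_upwards [self_mem_nhdsWithin] with ε hε
      refine (measure_mono (hSE ε hε)).trans ?_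
      have hmono : Monotone fun m => ⋂ n ≥ m, E ε n := fun m k hmk =>
        biInter_subset_biInter_left fun n hn => hmk.trans hn
      rw [hmono.measure_iUnion]
      exact iSup_le fun m => (measure_mono (biInter_subset_of_mem le_rfl)).trans (hEP ε hε m)
  filter_upwards [hWB, measure_eq_zero_iff_ae_notMem.mp hS0] with ω hω hωS hcon
  exact hωS (by simpa only [hS, mem_ofPred_eq, hω] using hcon)

/-- For every `α ∈ ℝ`,
`P( lim_{t↑T} ∫₀ᵗ (X^{(α)}_u)²/(T−u)² du = ∞ ) = 1`. -/
theorem energy_integral_tendsto_atTop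
    (P : Measure Ω) [IsProbabilityMeasure P]
    (T α : ℝ) (hT : 0 < T) (B : ℝ → Ω → ℝ) (hB : IsStandardWiener P B) :
    ∀ᵐ ω ∂P, Tendsto
      (fun t => ∫ u in Set.Ioc (0:ℝ) t, alphaWienerBridge T α B u ω ^ 2 / (T - u) ^ 2)
      (𝓝[<] T) atTop := by
  filter_upwards [hB.cont, hB.ae_not_forall_eventually_integral_abs_increment_le hT] with ω hc hω
  exact (tendsto_energy_atTop_or_eventually_le hT hc).resolve_right hω
end
end
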